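/- Let n ≥ 5, t ≥ 2 and n ≥ 2t + 1, and let G be a cactus with n vertices and exactly t cycles such that W_e(G) ≥ W_e(H) for every cactus H with n vertices and exactly t cycles. Then G contains no pendant path, i.e., there is no path v0v1⋯v_k in G with k ≥ 1 such that d_G(v0) ≥ 3, d_G(v_i) = 2 for all 0 < i < k, and d_G(v_k) = 1. -/

import Mathlib

open SimpleGraph Finset
open scoped Classical

/-- The distance `d_G(f,g)` between two edges: `0` if they coincide, otherwise the minimum
distance between endpoints plus one (i.e. the distance in the line graph). -/
noncomputable def eDist {V : Type*} (G : SimpleGraph V) (e f : Sym2 V) : ℕ :=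
  if e = f then 0 else sInf {n : ℕ | ∃ u ∈ e, ∃ w ∈ f, G.dist u w = n} + 1

/-- The distance `d_G(v,f)` between a vertex and an edge: the minimum distance to an endpoint. -/
noncomputable def vDist {V : Type*} (G : SimpleGraph V) (v : V) (e : Sym2 V) : ℕ :=
  sInf {n : ℕ | ∃ u ∈ e, G.dist v u = n}

/-- The edge-Wiener index `W_e(G)`: the sum of `eDist` over unordered pairs of edges. -/
noncomputable def edgeWiener {V : Type*} [Fintype V] (G : SimpleGraph V) : ℕ :=
  (∑ e ∈ G.edgeFinset, ∑ f ∈ G.edgeFinset, eDist G e f) / 2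

/-- A cactus: a connected simple graph in which any two distinct cycles (distinguished by
their edge sets) share at most one vertex. -/
def IsCactus {V : Type*} (G : SimpleGraph V) : Prop :=
  G.Connected ∧ ∀ (u w : V) (c1 : G.Walk u u) (c2 : G.Walk w w),
    c1.IsCycle → c2.IsCycle → c1.edges.toFinset ≠ c2.edges.toFinset →
      (c1.support.toFinset ∩ c2.support.toFinset).card ≤ 1

/-! ### Generic lemmas on distances -/

lemma dist_le_of_weakHom {V W : Type*} {G : SimpleGraph V} {H : SimpleGraph W} (r : W → V)
    (h : ∀ u w, H.Adj u w → r u = r w ∨ G.Adj (r u) (r w)) (u w : W)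
    (hr : H.Reachable u w) : G.dist (r u) (r w) ≤ H.dist u w := by
  obtain ⟨p, hp⟩ := hr.exists_walk_length_eq_dist
  rw [← hp]
  have key : ∀ (u w : W) (p : H.Walk u w), ∃ q : G.Walk (r u) (r w), q.length ≤ p.length := by
    intro u w p
    induction p with
    | nil => exact ⟨Walk.nil, le_rfl⟩
    | cons hadj p ih =>
      obtain ⟨q, hq⟩ := ih
      rcases h _ _ hadj with h1 | h1
      · rw [h1]
        exact ⟨q, by simp; omega⟩
      · exact ⟨Walk.cons h1 q, by simp; omega⟩
  obtain ⟨q, hq⟩ := key u w p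
  exact (SimpleGraph.dist_le q).trans hq

lemma pot_le_dist {W : Type*} {H : SimpleGraph W} (f : W → ℤ)
    (h : ∀ u w, H.Adj u w → f w - f u ≤ 1) (u w : W)
    (hr : H.Reachable u w) : f w - f u ≤ H.dist u w := by
  obtain ⟨p, hp⟩ := hr.exists_walk_length_eq_dist
  rw [← hp]
  clear hp hr
  induction p with
  | nil => simp
  | cons hadj p ih =>
    have := h _ _ hadj
    simp only [Walk.length_cons]
    push_cast
    linarith

lemma eDist_self {V : Type*} (G : SimpleGraph V) (e : Sym2 V) : eDist G e e = 0 := by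
  simp [eDist]

lemma eDist_le {V : Type*} (G : SimpleGraph V) {e f : Sym2 V} {u w : V} (hu : u ∈ e)
    (hw : w ∈ f) : eDist G e f ≤ G.dist u w + 1 := by
  unfold eDist
  split_ifs
  · omega
  · have : sInf {n : ℕ | ∃ u ∈ e, ∃ w ∈ f, G.dist u w = n} ≤ G.dist u w :=
      Nat.sInf_le ⟨u, hu, w, hw, rfl⟩
    omega

lemma eDist_exists {V : Type*} (G : SimpleGraph V) {e f : Sym2 V} (h : e ≠ f) :
    ∃ u ∈ e, ∃ w ∈ f, eDist G e f = G.dist u w + 1 := by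
  have hne : {n : ℕ | ∃ u ∈ e, ∃ w ∈ f, G.dist u w = n}.Nonempty :=
    ⟨_, e.out.1, Sym2.out_fst_mem e, f.out.1, Sym2.out_fst_mem f, rfl⟩
  obtain ⟨u, hu, w, hw, h1⟩ := Nat.sInf_mem hne
  exact ⟨u, hu, w, hw, by rw [eDist, if_neg h, h1]⟩

lemma eDist_comm {V : Type*} (G : SimpleGraph V) (e f : Sym2 V) :
    eDist G e f = eDist G f e := by
  by_cases h : e = f
  · rw [h]
  · apply le_antisymm
    · obtain ⟨u, hu, w, hw, h1⟩ := eDist_exists G (Ne.symm h)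
      rw [h1, SimpleGraph.dist_comm]
      exact eDist_le G hw hu
    · obtain ⟨u, hu, w, hw, h1⟩ := eDist_exists G h
      rw [h1, SimpleGraph.dist_comm]
      exact eDist_le G hw hu

lemma eDist_map_le {V W : Type*} {G : SimpleGraph V} {H : SimpleGraph W} (hH : H.Connected)
    (r : W → V) (h : ∀ u w, H.Adj u w → r u = r w ∨ G.Adj (r u) (r w)) (e f : Sym2 W) :
    eDist G (e.map r) (f.map r) ≤ eDist H e f := by
  by_cases hef : e = f
  · rw [hef, eDist_self, eDist_self]
  · obtain ⟨u, hu, w, hw, h1⟩ := eDist_exists H hef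
    rw [h1]
    have h2 := dist_le_of_weakHom r h u w (hH u w)
    have h3 := eDist_le G (Sym2.mem_map.2 ⟨u, hu, rfl⟩ : r u ∈ e.map r)
      (Sym2.mem_map.2 ⟨w, hw, rfl⟩ : r w ∈ f.map r)
    omega

lemma vDist_le {V : Type*} (G : SimpleGraph V) (v : V) {e : Sym2 V} {u : V} (hu : u ∈ e) :
    vDist G v e ≤ G.dist v u := Nat.sInf_le ⟨u, hu, rfl⟩

lemma vDist_exists {V : Type*} (G : SimpleGraph V) (v : V) (e : Sym2 V) :
    ∃ u ∈ e, vDist G v e = G.dist v u := by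
  have hne : {n : ℕ | ∃ u ∈ e, G.dist v u = n}.Nonempty :=
    ⟨_, e.out.1, Sym2.out_fst_mem e, rfl⟩
  obtain ⟨u, hu, h1⟩ := Nat.sInf_mem hne
  exact ⟨u, hu, h1.symm⟩

/-! ### Double sums -/

lemma dsum_union {E : Type*} [DecidableEq E] (d : E → E → ℕ) (hc : ∀ e f, d e f = d f e) (s t : Finset E)
    (hst : Disjoint s t) :
    ∑ e ∈ s ∪ t, ∑ f ∈ s ∪ t, d e f =
      ∑ e ∈ s, ∑ f ∈ s, d e f + ∑ e ∈ t, ∑ f ∈ t, d e f + 2 * ∑ e ∈ s, ∑ f ∈ t, d e f := by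
  rw [Finset.sum_union hst]
  simp_rw [Finset.sum_union hst, Finset.sum_add_distrib]
  have : ∑ x ∈ t, ∑ x_1 ∈ s, d x x_1 = ∑ e ∈ s, ∑ f ∈ t, d e f := by
    rw [Finset.sum_comm]
    exact Finset.sum_congr rfl fun _ _ => Finset.sum_congr rfl fun _ _ => hc _ _
  rw [this]
  ring

lemma dsum_even {E : Type*} [DecidableEq E] (d : E → E → ℕ) (hc : ∀ e f, d e f = d f e) (h0 : ∀ e, d e e = 0)
    (s : Finset E) : Even (∑ e ∈ s, ∑ f ∈ s, d e f) := by
  induction s using Finset.induction_on with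
  | empty => simp
  | insert a s ha ih =>
    rw [Finset.insert_eq, dsum_union d hc _ _ (by simpa using ha)]
    simp only [Finset.sum_singleton, h0, zero_add]
    exact ih.add (even_two_mul _)

lemma edgeWiener_le_iff {V : Type*} [Fintype V] (G H : SimpleGraph V) :
    edgeWiener H ≤ edgeWiener G → ∑ e ∈ H.edgeFinset, ∑ f ∈ H.edgeFinset, eDist H e f ≤
      ∑ e ∈ G.edgeFinset, ∑ f ∈ G.edgeFinset, eDist G e f := by
  unfold edgeWiener
  obtain ⟨a, ha⟩ := dsum_even (eDist H) (eDist_comm H) (eDist_self H) H.edgeFinset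
  obtain ⟨b, hb⟩ := dsum_even (eDist G) (eDist_comm G) (eDist_self G) G.edgeFinset
  rw [ha, hb]
  omega

/-! ### The cactus property -/

/-- The cycle condition in the definition of a cactus. -/
def CycProp {V : Type*} (G : SimpleGraph V) : Prop :=
  ∀ (u w : V) (c1 : G.Walk u u) (c2 : G.Walk w w),
    c1.IsCycle → c2.IsCycle → c1.edges.toFinset ≠ c2.edges.toFinset →
      (c1.support.toFinset ∩ c2.support.toFinset).card ≤ 1

lemma walk_through {V : Type*} {H : SimpleGraph V} (X : Set V) (z : V)
    (hX : ∀ x ∈ X, ∀ w, H.Adj x w → w ∈ X ∨ w = z) {x y : V} (p : H.Walk x y) (hx : x ∈ X)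
    (hy : y ∉ X) : z ∈ p.support := by
  induction p with
  | nil => exact absurd hx hy
  | cons h p ih =>
    rcases hX _ hx _ h with h1 | h1
    · exact List.mem_cons_of_mem _ (ih h1 hy)
    · subst h1
      simp

lemma cycle_block {V : Type*} {H : SimpleGraph V} (X : Set V) (z : V) (hz : z ∉ X)
    (hX : ∀ x ∈ X, ∀ w, H.Adj x w → w ∈ X ∨ w = z) {u : V} (c : H.Walk u u) (hc : c.IsCycle)
    {x : V} (hxc : x ∈ c.support) (hx : x ∈ X) : ∀ y ∈ c.support, y ∈ X ∨ y = z := by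
  intro y hy
  by_contra hcon
  push Not at hcon
  obtain ⟨hyX, hyz⟩ := hcon
  have hc' : (c.rotate x hxc).IsCycle := hc.rotate hxc
  have hy' : y ∈ (c.rotate x hxc).support := by
    rw [Walk.mem_support_rotate_iff]; exact hy
  set d := c.rotate x hxc with hd
  have h1 : z ∈ (d.takeUntil y hy').support := walk_through X z hX _ hx hyX
  have h2 : z ∈ (d.dropUntil y hy').reverse.support := walk_through X z hX _ hx hyX
  rw [Walk.support_reverse, List.mem_reverse] at h2
  have hnd := hc'.support_nodup
  rw [← Walk.take_spec d hy', Walk.tail_support_append] at hnd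
  have h1' : z ∈ (d.takeUntil y hy').support.tail := by
    rw [← Walk.cons_tail_support] at h1
    rcases List.mem_cons.1 h1 with h | h
    · exact absurd (h ▸ hx) hz
    · exact h
  have h2' : z ∈ (d.dropUntil y hy').support.tail := by
    rw [← Walk.cons_tail_support] at h2
    rcases List.mem_cons.1 h2 with h | h
    · exact absurd h.symm hyz
    · exact h
  exact (List.nodup_append.1 hnd).2.2 _ h1' _ h2' rfl

lemma transfer_cycle {V : Type*} {H K : SimpleGraph V} (S : Set V)
    (h : ∀ u w, H.Adj u w → u ∈ S → w ∈ S → K.Adj u w) {u : V} (c : H.Walk u u)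
    (hc : c.IsCycle) (hS : ∀ y ∈ c.support, y ∈ S) :
    ∃ d : K.Walk u u, d.IsCycle ∧ d.edges = c.edges ∧ d.support = c.support := by
  have hE : ∀ e ∈ c.edges, e ∈ K.edgeSet := by
    intro e he
    induction e using Sym2.ind with
    | _ a b =>
      exact h a b (c.adj_of_mem_edges he) (hS _ (c.fst_mem_support_of_mem_edges he))
        (hS _ (c.snd_mem_support_of_mem_edges he))
  exact ⟨c.transfer K hE, hc.transfer hE, c.edges_transfer hE, c.support_transfer hE⟩

lemma cp_glue {V : Type*} (H K1 K2 : SimpleGraph V) (X : Set V) (z : V) (hz : z ∉ X)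
    (hX : ∀ x ∈ X, ∀ w, H.Adj x w → w ∈ X ∨ w = z) (h1 : CycProp K1) (h2 : CycProp K2)
    (hin : ∀ u w, H.Adj u w → (u ∈ X ∨ u = z) → (w ∈ X ∨ w = z) → K1.Adj u w)
    (hout : ∀ u w, H.Adj u w → u ∉ X → w ∉ X → K2.Adj u w) : CycProp H := by
  have mixed : ∀ (u w : V) (c1 : H.Walk u u) (c2 : H.Walk w w),
      c1.IsCycle → c2.IsCycle → (∃ x ∈ c1.support, x ∈ X) → (¬ ∃ x ∈ c2.support, x ∈ X) →
      (c1.support.toFinset ∩ c2.support.toFinset).card ≤ 1 := by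
    rintro u w c1 c2 hc1 hc2 ⟨x, hx, hxX⟩ hn
    push Not at hn
    have hb := cycle_block X z hz hX c1 hc1 hx hxX
    rw [Finset.card_le_one]
    intro a ha b hb'
    simp only [Finset.mem_inter, List.mem_toFinset] at ha hb'
    rw [(hb a ha.1).resolve_left (hn a ha.2), (hb b hb'.1).resolve_left (hn b hb'.2)]
  intro u w c1 c2 hc1 hc2 hne
  by_cases t1 : ∃ x ∈ c1.support, x ∈ X
  · by_cases t2 : ∃ x ∈ c2.support, x ∈ X
    · obtain ⟨x1, hx1, hx1'⟩ := t1
      obtain ⟨x2, hx2, hx2'⟩ := t2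
      obtain ⟨d1, e1, e2, e3⟩ := transfer_cycle {y | y ∈ X ∨ y = z} hin c1 hc1
        (cycle_block X z hz hX c1 hc1 hx1 hx1')
      obtain ⟨d2, f1, f2, f3⟩ := transfer_cycle {y | y ∈ X ∨ y = z} hin c2 hc2
        (cycle_block X z hz hX c2 hc2 hx2 hx2')
      rw [← e3, ← f3]
      exact h1 _ _ d1 d2 e1 f1 (by rw [e2, f2]; exact hne)
    · exact mixed _ _ c1 c2 hc1 hc2 t1 t2
  · by_cases t2 : ∃ x ∈ c2.support, x ∈ X
    · rw [Finset.inter_comm]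
      exact mixed _ _ c2 c1 hc2 hc1 t2 t1
    · push Not at t1 t2
      obtain ⟨d1, e1, e2, e3⟩ := transfer_cycle Xᶜ hout c1 hc1 t1
      obtain ⟨d2, f1, f2, f3⟩ := transfer_cycle Xᶜ hout c2 hc2 t2
      rw [← e3, ← f3]
      exact h2 _ _ d1 d2 e1 f1 (by rw [e2, f2]; exact hne)

lemma cp_comap {V W : Type*} (G : SimpleGraph V) (s : W → V) (hs : Function.Injective s)
    (h : CycProp G) : CycProp (G.comap s) := by
  intro u w c1 c2 hc1 hc2 hne
  let φ : G.comap s →g G := ⟨s, fun h => h⟩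
  have hφ : Function.Injective φ := hs
  have h3 := h _ _ (c1.map φ) (c2.map φ) (hc1.map hφ) (hc2.map hφ) (by
    intro heq
    apply hne
    rw [Walk.edges_map, Walk.edges_map] at heq
    have hi : Function.Injective (Sym2.map φ) := Sym2.map.injective hφ
    ext e
    have := Finset.ext_iff.1 heq (Sym2.map φ e)
    simpa [List.mem_map, hi.eq_iff] using this)
  rw [Walk.support_map, Walk.support_map] at h3
  refine le_trans ?_ h3
  rw [← Finset.card_image_of_injective _ hs]
  apply Finset.card_le_card
  intro y hy
  simp only [Finset.mem_image, Finset.mem_inter, List.mem_toFinset, List.mem_map] at hy ⊢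
  obtain ⟨x, ⟨h1, h2⟩, rfl⟩ := hy
  exact ⟨⟨x, h1, rfl⟩, ⟨x, h2, rfl⟩⟩

lemma cp_triangle {V : Type*} (K : SimpleGraph V) (a b c : V)
    (h : ∀ u w, K.Adj u w → (u = a ∨ u = b ∨ u = c) ∧ (w = a ∨ w = b ∨ w = c)) : CycProp K := by
  have key : ∀ (u : V) (d : K.Walk u u), d.IsCycle →
      d.edges.toFinset = {s(a, b), s(b, c), s(a, c)} := by
    intro u d hd
    apply Finset.eq_of_subset_of_card_le
    · intro e he
      rw [List.mem_toFinset] at he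
      induction e using Sym2.ind with
      | _ x y =>
        have hadj := d.adj_of_mem_edges he
        have hne := hadj.ne
        obtain ⟨h1, h2⟩ := h _ _ hadj
        rcases h1 with rfl | rfl | rfl <;> rcases h2 with rfl | rfl | rfl <;>
          simp_all [Sym2.eq_swap]
    · rw [List.toFinset_card_of_nodup hd.isTrail.edges_nodup, Walk.length_edges]
      exact Finset.card_le_three.trans hd.three_le_length
  intro u w c1 c2 hc1 hc2 hne
  exact absurd ((key _ _ hc1).trans (key _ _ hc2).symm) hne

lemma connected_of_adj {V : Type*} {G H : SimpleGraph V} (hG : G.Connected)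
    (h : ∀ u w, G.Adj u w → H.Reachable u w) : H.Connected := by
  have := hG.nonempty
  refine ⟨fun u w => ?_⟩
  obtain ⟨p⟩ := hG u w
  induction p with
  | nil => exact Reachable.refl _
  | cons hadj p ih => exact (h _ _ hadj).trans ih

/-! ### Pendant paths -/

/-- `p 0, ..., p k` is a path all of whose vertices except `p 0` have only path neighbours. -/
structure PendPath {V : Type*} (G : SimpleGraph V) (k : ℕ) (p : ℕ → V) : Prop where
  hk : 1 ≤ k
  inj : ∀ i ≤ k, ∀ j ≤ k, p i = p j → i = j
  adj : ∀ i < k, G.Adj (p i) (p (i + 1))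
  nb : ∀ i, 0 < i → i ≤ k → ∀ w, G.Adj (p i) w → w = p (i - 1) ∨ (i < k ∧ w = p (i + 1))

lemma PendPath.exists_ix {V : Type*} {G : SimpleGraph V} {k : ℕ} {p : ℕ → V}
    (hp : PendPath G k p) : ∃ ix : V → ℕ, ∀ i ≤ k, ix (p i) = i := by
  refine ⟨fun w => if h : ∃ i ≤ k, p i = w then h.choose else 0, fun i hi => ?_⟩
  have h : ∃ j ≤ k, p j = p i := ⟨i, hi, rfl⟩
  simp only [dif_pos h]
  exact hp.inj _ h.choose_spec.1 _ hi h.choose_spec.2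

lemma PendPath.padj {V : Type*} {G : SimpleGraph V} {k : ℕ} {p : ℕ → V}
    (hp : PendPath G k p) {i j : ℕ} (hi : i ≤ k) (hj : j ≤ k) (h : G.Adj (p i) (p j)) :
    i = j + 1 ∨ j = i + 1 := by
  rcases Nat.eq_zero_or_pos i with h0 | h0
  · rcases Nat.eq_zero_or_pos j with h1 | h1
    · subst h0 h1
      exact absurd rfl h.ne
    · rcases hp.nb j h1 hj _ h.symm with h2 | ⟨h3, h2⟩
      · have := hp.inj _ hi _ (by omega) h2
        omega
      · have := hp.inj _ hi _ (by omega) h2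
        omega
  · rcases hp.nb i h0 hi _ h with h2 | ⟨h3, h2⟩
    · have := hp.inj _ hj _ (by omega) h2
      omega
    · have := hp.inj _ hj _ (by omega) h2
      omega

lemma PendPath.dist_le {V : Type*} {G : SimpleGraph V} {k : ℕ} {p : ℕ → V}
    (hp : PendPath G k p) (i j : ℕ) (hij : i + j ≤ k) : G.dist (p i) (p (i + j)) ≤ j := by
  have : ∀ j, i + j ≤ k → ∃ q : G.Walk (p i) (p (i + j)), q.length = j := by
    intro j
    induction j with
    | zero => intro _; exact ⟨Walk.nil, rfl⟩
    | succ j ih =>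
      intro h
      obtain ⟨q, hq⟩ := ih (by omega)
      exact ⟨q.concat (hp.adj (i + j) (by omega)), by rw [Walk.length_concat, hq]⟩
  obtain ⟨q, hq⟩ := this j hij
  exact (SimpleGraph.dist_le q).trans hq.le

lemma reach_path {V : Type*} {H : SimpleGraph V} {k : ℕ} {p : ℕ → V}
    (h : ∀ i < k, H.Adj (p i) (p (i + 1))) : ∀ i ≤ k, H.Reachable (p 0) (p i) := by
  intro i
  induction i with
  | zero => intro _; exact Reachable.refl _
  | succ i ih => intro hi; exact (ih (by omega)).trans (h i (by omega)).reachable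

/-- Double sum of edge distances. -/
noncomputable def dW {V : Type*} [Fintype V] (G : SimpleGraph V) : ℕ :=
  ∑ e ∈ G.edgeFinset, ∑ f ∈ G.edgeFinset, eDist G e f

/-- If the base vertex of a pendant path separates the rest of the graph, moving one part to
the other end of the path increases the index. -/
lemma caseB {V : Type*} [Fintype V] (G : SimpleGraph V) (hG : IsCactus G) (k : ℕ) (p : ℕ → V)
    (hp : PendPath G k p) (X Y : Set V) (hcov : ∀ w, w ∈ X ∨ w ∈ Y ∨ ∃ i ≤ k, w = p i)
    (hXY : ∀ w ∈ X, w ∉ Y) (hXP : ∀ i ≤ k, p i ∉ X) (hYP : ∀ i ≤ k, p i ∉ Y)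
    (hadj : ∀ x ∈ X, ∀ y ∈ Y, ¬ G.Adj x y) (hXne : X.Nonempty) (hYne : Y.Nonempty) :
    ∃ H : SimpleGraph V, IsCactus H ∧ H.edgeFinset.card = G.edgeFinset.card ∧ dW G < dW H := by
  have hk := hp.hk
  obtain ⟨ix, hix⟩ := hp.exists_ix
  have xadj : ∀ x ∈ X, ∀ w, G.Adj x w → w ∈ X ∨ w = p 0 := by
    intro x hx w hw
    rcases hcov w with h | h | ⟨i, hi, rfl⟩
    · exact Or.inl h
    · exact absurd hw (hadj x hx w h)
    · rcases Nat.eq_zero_or_pos i with h0 | h0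
      · right; rw [h0]
      · rcases hp.nb i h0 hi _ hw.symm with h2 | ⟨h3, h2⟩
        · exact absurd (h2 ▸ hx) (hXP _ (by omega))
        · exact absurd (h2 ▸ hx) (hXP _ (by omega))
  have yadj : ∀ x ∈ Y, ∀ w, G.Adj x w → w ∈ Y ∨ w = p 0 := by
    intro x hx w hw
    rcases hcov w with h | h | ⟨i, hi, rfl⟩
    · exact absurd hw.symm (hadj w h x hx)
    · exact Or.inl h
    · rcases Nat.eq_zero_or_pos i with h0 | h0
      · right; rw [h0]
      · rcases hp.nb i h0 hi _ hw.symm with h2 | ⟨h3, h2⟩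
        · exact absurd (h2 ▸ hx) (hYP _ (by omega))
        · exact absurd (h2 ▸ hx) (hYP _ (by omega))
  have hp0X := hXP 0 (by omega)
  have hp0Y := hYP 0 (by omega)
  have hpkX := hXP k le_rfl
  have hpkY := hYP k le_rfl
  have hp0k : p 0 ≠ p k := fun h => by
    have := hp.inj _ (by omega) _ le_rfl h
    omega
  obtain ⟨H, Hdef⟩ : ∃ H : SimpleGraph V, ∀ u w, H.Adj u w ↔ ((u ∈ X ∧ w ∈ X ∧ G.Adj u w) ∨
      (u ∈ X ∧ w = p k ∧ G.Adj u (p 0)) ∨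
        (w ∈ X ∧ u = p k ∧ G.Adj w (p 0)) ∨ (u ∉ X ∧ w ∉ X ∧ G.Adj u w)) := ⟨
    { Adj := fun u w => (u ∈ X ∧ w ∈ X ∧ G.Adj u w) ∨ (u ∈ X ∧ w = p k ∧ G.Adj u (p 0)) ∨
        (w ∈ X ∧ u = p k ∧ G.Adj w (p 0)) ∨ (u ∉ X ∧ w ∉ X ∧ G.Adj u w)
      symm := ⟨by
        intro u w h
        rcases h with ⟨h1, h2, h3⟩ | h | h | ⟨h1, h2, h3⟩
        · exact Or.inl ⟨h2, h1, h3.symm⟩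
        · exact Or.inr (Or.inr (Or.inl h))
        · exact Or.inr (Or.inl h)
        · exact Or.inr (Or.inr (Or.inr ⟨h2, h1, h3.symm⟩))⟩
      loopless := ⟨by
        intro u h
        rcases h with ⟨h1, h2, h3⟩ | ⟨h1, h2, h3⟩ | ⟨h1, h2, h3⟩ | ⟨h1, h2, h3⟩
        · exact h3.ne rfl
        · exact hpkX (h2 ▸ h1)
        · exact hpkX (h2 ▸ h1)
        · exact h3.ne rfl⟩ }, fun u w => Iff.rfl⟩
  have Gcase : ∀ u w, G.Adj u w → u ∉ X → w ∉ X → ((u ∈ Y ∧ w ∈ Y) ∨ (u ∈ Y ∧ w = p 0) ∨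
      (u = p 0 ∧ w ∈ Y) ∨ (∃ i < k, u = p i ∧ w = p (i + 1)) ∨
        (∃ i < k, u = p (i + 1) ∧ w = p i)) := by
    intro u w h hu hw
    rcases hcov u with h1 | h1 | ⟨i, hi, rfl⟩
    · exact absurd h1 hu
    · rcases yadj u h1 w h with h2 | h2
      · exact Or.inl ⟨h1, h2⟩
      · exact Or.inr (Or.inl ⟨h1, h2⟩)
    · rcases hcov w with h2 | h2 | ⟨j, hj, rfl⟩
      · exact absurd h2 hw
      · rcases yadj w h2 _ h.symm with h3 | h3
        · exact absurd h3 (hYP i hi)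
        · exact Or.inr (Or.inr (Or.inl ⟨h3, h2⟩))
      · rcases hp.padj hi hj h with rfl | rfl
        · exact Or.inr (Or.inr (Or.inr (Or.inr ⟨j, by omega, rfl, rfl⟩)))
        · exact Or.inr (Or.inr (Or.inr (Or.inl ⟨i, by omega, rfl, rfl⟩)))
  have Hpath : ∀ i < k, H.Adj (p i) (p (i + 1)) := fun i hi => (Hdef _ _).2
    (Or.inr (Or.inr (Or.inr ⟨hXP i (by omega), hXP _ (by omega), hp.adj i hi⟩)))
  have Hreach := reach_path Hpath
  -- connectivity
  have Hconn : H.Connected := by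
    apply connected_of_adj hG.1
    intro u w h
    by_cases hu : u ∈ X
    · rcases xadj u hu w h with hw | rfl
      · exact ((Hdef u w).2 (Or.inl ⟨hu, hw, h⟩)).reachable
      · have h1 : H.Adj u (p k) := (Hdef _ _).2 (Or.inr (Or.inl ⟨hu, rfl, h⟩))
        exact h1.reachable.trans (Hreach k le_rfl).symm
    · by_cases hw : w ∈ X
      · rcases xadj w hw u h.symm with h2 | rfl
        · exact absurd h2 hu
        · have h1 : H.Adj w (p k) := (Hdef _ _).2 (Or.inr (Or.inl ⟨hw, rfl, h.symm⟩))
          exact (h1.reachable.trans (Hreach k le_rfl).symm).symm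
      · exact ((Hdef u w).2 (Or.inr (Or.inr (Or.inr ⟨hu, hw, h⟩)))).reachable
  have hGcp : CycProp G := hG.2
  have Hcp : CycProp H := by
    refine cp_glue H (G.comap (Equiv.swap (p 0) (p k))) G X (p k) hpkX ?_
      (cp_comap G _ (Equiv.injective _) hGcp) hGcp ?_ ?_
    · intro x hx w hw
      rcases (Hdef _ _).1 hw with h | h | h | h
      · exact Or.inl h.2.1
      · exact Or.inr h.2.1
      · exact Or.inl h.1
      · exact absurd hx h.1
    · have sx : ∀ x ∈ X, Equiv.swap (p 0) (p k) x = x := by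
        intro x hx
        apply Equiv.swap_apply_of_ne_of_ne
        · rintro rfl; exact hp0X hx
        · rintro rfl; exact hpkX hx
      intro u w h hu hw
      rw [SimpleGraph.comap_adj]
      rcases (Hdef _ _).1 h with ⟨h1, h2, h3⟩ | ⟨h1, h2, h3⟩ | ⟨h1, h2, h3⟩ | ⟨h1, h2, h3⟩
      · rw [sx u h1, sx w h2]; exact h3
      · rw [sx u h1, h2, Equiv.swap_apply_right]; exact h3
      · rw [sx w h1, h2, Equiv.swap_apply_right]; exact h3.symm
      · have e1 := hu.resolve_left h1
        have e2 := hw.resolve_left h2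
        exact absurd (e1.trans e2.symm) h.ne
    · intro u w h hu hw
      rcases (Hdef _ _).1 h with ⟨h1, h2, h3⟩ | ⟨h1, h2, h3⟩ | ⟨h1, h2, h3⟩ | ⟨h1, h2, h3⟩
      · exact h3
      · exact absurd h1 hu
      · exact absurd h1 hw
      · exact h3
  -- edge sets
  let g : V → V := fun w => if w = p 0 then p k else w
  have g0 : g (p 0) = p k := by simp [g]
  have gX : ∀ x ∈ X, g x = x := by
    intro x hx
    have : x ≠ p 0 := by rintro rfl; exact hp0X hx
    simp [g, this]
  let EA : Finset (Sym2 V) := G.edgeFinset.filter (fun e => ∃ x ∈ e, x ∈ X)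
  let EB : Finset (Sym2 V) := G.edgeFinset.filter (fun e => ∃ x ∈ e, x ∈ Y)
  let EP : Finset (Sym2 V) := (Finset.range k).image (fun j => s(p j, p (j + 1)))
  let EA' : Finset (Sym2 V) := EA.image (Sym2.map g)
  have memA : ∀ e, e ∈ EA ↔ ∃ x w, G.Adj x w ∧ x ∈ X ∧ (w ∈ X ∨ w = p 0) ∧ e = s(x, w) := by
    intro e
    simp only [EA, Finset.mem_filter, SimpleGraph.mem_edgeFinset]
    constructor
    · rintro ⟨h1, x, hx, hxX⟩
      obtain ⟨w, rfl⟩ := hx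
      rw [SimpleGraph.mem_edgeSet] at h1
      exact ⟨x, w, h1, hxX, xadj x hxX w h1, rfl⟩
    · rintro ⟨x, w, h, hx, -, rfl⟩
      exact ⟨h, x, by simp, hx⟩
  have memB : ∀ e, e ∈ EB ↔ ∃ x w, G.Adj x w ∧ x ∈ Y ∧ (w ∈ Y ∨ w = p 0) ∧ e = s(x, w) := by
    intro e
    simp only [EB, Finset.mem_filter, SimpleGraph.mem_edgeFinset]
    constructor
    · rintro ⟨h1, x, hx, hxX⟩
      obtain ⟨w, rfl⟩ := hx
      rw [SimpleGraph.mem_edgeSet] at h1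
      exact ⟨x, w, h1, hxX, yadj x hxX w h1, rfl⟩
    · rintro ⟨x, w, h, hx, -, rfl⟩
      exact ⟨h, x, by simp, hx⟩
  have memP : ∀ e, e ∈ EP ↔ ∃ j < k, e = s(p j, p (j + 1)) := by
    intro e
    simp only [EP, Finset.mem_image, Finset.mem_range]
    constructor
    · rintro ⟨j, h, rfl⟩; exact ⟨j, h, rfl⟩
    · rintro ⟨j, h, rfl⟩; exact ⟨j, h, rfl⟩
  have memA' : ∀ e, e ∈ EA' ↔ ∃ x w, G.Adj x w ∧ x ∈ X ∧ (w ∈ X ∨ w = p 0) ∧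
      e = s(x, g w) := by
    intro e
    simp only [EA', Finset.mem_image]
    constructor
    · rintro ⟨e, he, rfl⟩
      obtain ⟨x, w, h1, h2, h3, rfl⟩ := (memA e).1 he
      exact ⟨x, w, h1, h2, h3, by rw [Sym2.map_mk, gX x h2]⟩
    · rintro ⟨x, w, h1, h2, h3, rfl⟩
      exact ⟨s(x, w), (memA _).2 ⟨x, w, h1, h2, h3, rfl⟩, by rw [Sym2.map_mk, gX x h2]⟩
  have notB : ∀ e ∈ EB, ∀ x ∈ e, x ∉ X := by
    intro e he x hx
    obtain ⟨y, w, h1, h2, h3, rfl⟩ := (memB e).1 he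
    rcases Sym2.mem_iff.1 hx with rfl | rfl
    · exact fun h => hXY _ h h2
    · rcases h3 with h3 | rfl
      · exact fun h => hXY _ h h3
      · exact hp0X
  have notP : ∀ e ∈ EP, ∀ x ∈ e, x ∉ X ∧ x ∉ Y := by
    intro e he x hx
    obtain ⟨j, hj, rfl⟩ := (memP e).1 he
    rcases Sym2.mem_iff.1 hx with rfl | rfl
    · exact ⟨hXP _ (by omega), hYP _ (by omega)⟩
    · exact ⟨hXP _ (by omega), hYP _ (by omega)⟩
  have dAB : Disjoint EA EB := by
    rw [Finset.disjoint_left]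
    intro e h1 h2
    obtain ⟨x, w, h3, h4, h5, rfl⟩ := (memA e).1 h1
    exact notB _ h2 x (by simp) h4
  have dABP : Disjoint (EA ∪ EB) EP := by
    rw [Finset.disjoint_left]
    intro e h1 h2
    rcases Finset.mem_union.1 h1 with h1 | h1
    · obtain ⟨x, w, h3, h4, h5, rfl⟩ := (memA e).1 h1
      exact (notP _ h2 x (by simp)).1 h4
    · obtain ⟨x, w, h3, h4, h5, rfl⟩ := (memB e).1 h1
      exact (notP _ h2 x (by simp)).2 h4
  have dA'B : Disjoint EA' EB := by
    rw [Finset.disjoint_left]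
    intro e h1 h2
    obtain ⟨x, w, h3, h4, h5, rfl⟩ := (memA' e).1 h1
    exact notB _ h2 x (by simp) h4
  have dA'BP : Disjoint (EA' ∪ EB) EP := by
    rw [Finset.disjoint_left]
    intro e h1 h2
    rcases Finset.mem_union.1 h1 with h1 | h1
    · obtain ⟨x, w, h3, h4, h5, rfl⟩ := (memA' e).1 h1
      exact (notP _ h2 x (by simp)).1 h4
    · obtain ⟨x, w, h3, h4, h5, rfl⟩ := (memB e).1 h1
      exact (notP _ h2 x (by simp)).2 h4
  have other : ∀ u w, G.Adj u w → u ∉ X → w ∉ X → s(u, w) ∈ EB ∪ EP := by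
    intro u w h hu hw
    rw [Finset.mem_union]
    rcases Gcase u w h hu hw with h1 | h1 | h1 | ⟨i, hi, rfl, rfl⟩ | ⟨i, hi, rfl, rfl⟩
    · exact Or.inl ((memB _).2 ⟨u, w, h, h1.1, Or.inl h1.2, rfl⟩)
    · exact Or.inl ((memB _).2 ⟨u, w, h, h1.1, Or.inr h1.2, rfl⟩)
    · exact Or.inl ((memB _).2 ⟨w, u, h.symm, h1.2, Or.inr h1.1, Sym2.eq_swap⟩)
    · exact Or.inr ((memP _).2 ⟨i, hi, rfl⟩)
    · exact Or.inr ((memP _).2 ⟨i, hi, Sym2.eq_swap⟩)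
  have otherG : ∀ e ∈ EB ∪ EP, e ∈ G.edgeSet := by
    intro e he
    rcases Finset.mem_union.1 he with he | he
    · obtain ⟨x, w, h3, h4, h5, rfl⟩ := (memB e).1 he
      exact h3
    · obtain ⟨j, hj, rfl⟩ := (memP e).1 he
      exact hp.adj j hj
  have EG : G.edgeFinset = (EA ∪ EB) ∪ EP := by
    ext e
    rw [SimpleGraph.mem_edgeFinset, Finset.union_assoc, Finset.mem_union]
    constructor
    · induction e using Sym2.ind with
      | _ u w =>
        intro h
        rw [SimpleGraph.mem_edgeSet] at h
        by_cases hu : u ∈ X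
        · exact Or.inl ((memA _).2 ⟨u, w, h, hu, xadj u hu w h, rfl⟩)
        · by_cases hw : w ∈ X
          · exact Or.inl ((memA _).2 ⟨w, u, h.symm, hw, xadj w hw u h.symm, Sym2.eq_swap⟩)
          · exact Or.inr (other u w h hu hw)
    · rintro (h | h)
      · obtain ⟨x, w, h3, h4, h5, rfl⟩ := (memA e).1 h
        exact h3
      · exact otherG e h
  have EH : H.edgeFinset = (EA' ∪ EB) ∪ EP := by
    ext e
    rw [SimpleGraph.mem_edgeFinset, Finset.union_assoc, Finset.mem_union]
    constructor
    · induction e using Sym2.ind with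
      | _ u w =>
        intro h
        rw [SimpleGraph.mem_edgeSet] at h
        rcases (Hdef _ _).1 h with ⟨h1, h2, h3⟩ | ⟨h1, rfl, h3⟩ | ⟨h1, rfl, h3⟩ | ⟨h1, h2, h3⟩
        · exact Or.inl ((memA' _).2 ⟨u, w, h3, h1, Or.inl h2, by rw [gX w h2]⟩)
        · exact Or.inl ((memA' _).2 ⟨u, p 0, h3, h1, Or.inr rfl, by rw [g0]⟩)
        · exact Or.inl ((memA' _).2 ⟨w, p 0, h3, h1, Or.inr rfl, by rw [g0, Sym2.eq_swap]⟩)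
        · exact Or.inr (other u w h3 h1 h2)
    · rintro (h | h)
      · obtain ⟨x, w, h3, h4, h5, rfl⟩ := (memA' e).1 h
        rw [SimpleGraph.mem_edgeSet, Hdef]
        rcases h5 with h5 | rfl
        · rw [gX w h5]; exact Or.inl ⟨h4, h5, h3⟩
        · rw [g0]; exact Or.inr (Or.inl ⟨h4, rfl, h3⟩)
      · have hg := otherG e h
        have hn : ∀ x ∈ e, x ∉ X := by
          rcases Finset.mem_union.1 h with h | h
          · exact notB e h
          · exact fun x hx => (notP e h x hx).1
        induction e using Sym2.ind with
        | _ u w =>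
          exact (Hdef _ _).2 (Or.inr (Or.inr (Or.inr ⟨hn u (by simp), hn w (by simp), hg⟩)))
  -- the retraction onto the part `X`
  let rA : V → V := fun w => if w ∈ X then w else if w ∈ Y then p k else p (k - ix w)
  have rAX : ∀ x ∈ X, rA x = x := fun x hx => by simp [rA, hx]
  have rAY : ∀ x ∈ Y, rA x = p k := fun x hx => by
    have : x ∉ X := fun h => hXY x h hx
    simp [rA, hx, this]
  have rAP : ∀ i ≤ k, rA (p i) = p (k - i) := fun i hi => by
    simp [rA, hXP i hi, hYP i hi, hix i hi]
  have rAh : ∀ u w, H.Adj u w → rA u = rA w ∨ G.Adj (rA u) (rA w) := by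
    intro u w h
    rcases (Hdef _ _).1 h with ⟨h1, h2, h3⟩ | ⟨h1, rfl, h3⟩ | ⟨h1, rfl, h3⟩ | ⟨h1, h2, h3⟩
    · rw [rAX u h1, rAX w h2]; exact Or.inr h3
    · rw [rAX u h1, rAP k le_rfl, Nat.sub_self]; exact Or.inr h3
    · rw [rAX w h1, rAP k le_rfl, Nat.sub_self]; exact Or.inr h3.symm
    · rcases Gcase u w h3 h1 h2 with h1 | ⟨h1, rfl⟩ | ⟨rfl, h4⟩ | ⟨i, hi, rfl, rfl⟩ |
        ⟨i, hi, rfl, rfl⟩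
      · left; rw [rAY u h1.1, rAY w h1.2]
      · left; rw [rAY u h1, rAP 0 (by omega), Nat.sub_zero]
      · left; rw [rAY w h4, rAP 0 (by omega), Nat.sub_zero]
      · right
        rw [rAP i (by omega), rAP (i + 1) (by omega)]
        have := hp.adj (k - (i + 1)) (by omega)
        rw [show k - (i + 1) + 1 = k - i by omega] at this
        exact this.symm
      · right
        rw [rAP i (by omega), rAP (i + 1) (by omega)]
        have := hp.adj (k - (i + 1)) (by omega)
        rw [show k - (i + 1) + 1 = k - i by omega] at this
        exact this
  have rAg : ∀ e ∈ EA, (e.map g).map rA = e := by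
    intro e he
    obtain ⟨x, w, h1, h2, h3, rfl⟩ := (memA e).1 he
    rw [Sym2.map_mk, Sym2.map_mk, gX x h2, rAX x h2]
    rcases h3 with h3 | rfl
    · rw [gX w h3, rAX w h3]
    · rw [g0, rAP k le_rfl, Nat.sub_self]
  have ginj : Set.InjOn (Sym2.map g) (EA : Set (Sym2 V)) := by
    intro e he f hf h
    rw [← rAg e he, ← rAg f hf, h]
  -- the retraction onto the rest
  let rB : V → V := fun w => if w ∈ X then p k else w
  have rBX : ∀ x ∈ X, rB x = p k := fun x hx => by simp [rB, hx]
  have rBn : ∀ x, x ∉ X → rB x = x := fun x hx => by simp [rB, hx]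
  have rBh : ∀ u w, H.Adj u w → rB u = rB w ∨ G.Adj (rB u) (rB w) := by
    intro u w h
    rcases (Hdef _ _).1 h with ⟨h1, h2, h3⟩ | ⟨h1, rfl, h3⟩ | ⟨h1, rfl, h3⟩ | ⟨h1, h2, h3⟩
    · left; rw [rBX u h1, rBX w h2]
    · left; rw [rBX u h1, rBn _ hpkX]
    · left; rw [rBX w h1, rBn _ hpkX]
    · right; rw [rBn u h1, rBn w h2]; exact h3
  have rBe : ∀ e : Sym2 V, (∀ x ∈ e, x ∉ X) → e.map rB = e := by
    intro e he
    induction e using Sym2.ind with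
    | _ u w => rw [Sym2.map_mk, rBn u (he u (by simp)), rBn w (he w (by simp))]
  have rest : ∀ e f : Sym2 V, (∀ x ∈ e, x ∉ X) → (∀ x ∈ f, x ∉ X) → eDist G e f ≤ eDist H e f := by
    intro e f he hf
    have := eDist_map_le Hconn rB rBh e f
    rwa [rBe e he, rBe f hf] at this
  -- the potential
  let φ : V → ℤ := fun w => if w ∈ X then (G.dist w (p 0) : ℤ) + k else
    if w ∈ Y then - (G.dist w (p 0) : ℤ) else ix w
  have φX : ∀ x ∈ X, φ x = (G.dist x (p 0) : ℤ) + k := fun x hx => by simp [φ, hx]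
  have φY : ∀ x ∈ Y, φ x = - (G.dist x (p 0) : ℤ) := fun x hx => by
    have : x ∉ X := fun h => hXY x h hx
    simp [φ, hx, this]
  have φP : ∀ i ≤ k, φ (p i) = i := fun i hi => by simp [φ, hXP i hi, hYP i hi, hix i hi]
  have dlip : ∀ u w, G.Adj u w → (G.dist u (p 0) : ℤ) - G.dist w (p 0) ≤ 1 := by
    intro u w h
    have h1 := hG.1.dist_triangle (u := u) (v := w) (w := p 0)
    have h2 : G.dist u w = 1 := SimpleGraph.dist_eq_one_iff_adj.2 h
    omega
  have φh : ∀ u w, H.Adj u w → φ w - φ u ≤ 1 := by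
    intro u w h
    have d0 : G.dist (p 0) (p 0) = 0 := SimpleGraph.dist_self
    rcases (Hdef _ _).1 h with ⟨h1, h2, h3⟩ | ⟨h1, rfl, h3⟩ | ⟨h1, rfl, h3⟩ | ⟨h1, h2, h3⟩
    · rw [φX u h1, φX w h2]
      have := dlip w u h3.symm
      linarith
    · rw [φX u h1, φP k le_rfl]
      omega
    · rw [φX w h1, φP k le_rfl]
      have := dlip w _ h3
      rw [d0] at this
      push_cast at this
      linarith
    · rcases Gcase u w h3 h1 h2 with h1 | ⟨h1, rfl⟩ | ⟨rfl, h4⟩ | ⟨i, hi, rfl, rfl⟩ |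
        ⟨i, hi, rfl, rfl⟩
      · rw [φY u h1.1, φY w h1.2]
        have := dlip u w h3
        linarith
      · rw [φY u h1, φP 0 (by omega)]
        have := dlip u _ h3
        rw [d0] at this
        push_cast at this ⊢
        linarith
      · rw [φY w h4, φP 0 (by omega)]
        push_cast
        omega
      · rw [φP i (by omega), φP (i + 1) (by omega)]
        push_cast
        linarith
      · rw [φP i (by omega), φP (i + 1) (by omega)]
        push_cast
        linarith
  -- comparison of the pieces
  have cAA : ∑ e ∈ EA, ∑ f ∈ EA, eDist G e f ≤ ∑ e ∈ EA', ∑ f ∈ EA', eDist H e f := by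
    rw [Finset.sum_image ginj]
    refine Finset.sum_le_sum fun e he => ?_
    rw [Finset.sum_image ginj]
    refine Finset.sum_le_sum fun f hf => ?_
    have := eDist_map_le Hconn rA rAh (e.map g) (f.map g)
    rwa [rAg e he, rAg f hf] at this
  have cBB : ∑ e ∈ EB, ∑ f ∈ EB, eDist G e f ≤ ∑ e ∈ EB, ∑ f ∈ EB, eDist H e f :=
    Finset.sum_le_sum fun e he => Finset.sum_le_sum fun f hf =>
      rest e f (notB e he) (notB f hf)
  have cPP : ∑ e ∈ EP, ∑ f ∈ EP, eDist G e f ≤ ∑ e ∈ EP, ∑ f ∈ EP, eDist H e f :=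
    Finset.sum_le_sum fun e he => Finset.sum_le_sum fun f hf =>
      rest e f (fun x hx => (notP e he x hx).1) (fun x hx => (notP f hf x hx).1)
  have cBP : ∑ e ∈ EB, ∑ f ∈ EP, eDist G e f ≤ ∑ e ∈ EB, ∑ f ∈ EP, eDist H e f :=
    Finset.sum_le_sum fun e he => Finset.sum_le_sum fun f hf =>
      rest e f (notB e he) (fun x hx => (notP f hf x hx).1)
  have pinj : Set.InjOn (fun j => s(p j, p (j + 1))) (Finset.range k : Set ℕ) := by
    intro i hi j hj h
    simp only [Finset.coe_range, Set.mem_Iio] at hi hj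
    rcases Sym2.eq_iff.1 h with ⟨h1, h2⟩ | ⟨h1, h2⟩
    · exact hp.inj _ (by omega) _ (by omega) h1
    · have e1 := hp.inj _ (by omega) _ (by omega) h1
      have e2 := hp.inj _ (by omega) _ (by omega) h2
      omega
  have cAP : ∑ e ∈ EA, ∑ f ∈ EP, eDist G e f ≤ ∑ e ∈ EA', ∑ f ∈ EP, eDist H e f := by
    rw [Finset.sum_image ginj]
    refine Finset.sum_le_sum fun e he => ?_
    rw [Finset.sum_image pinj, Finset.sum_image pinj]
    rw [← Finset.sum_range_reflect]
    refine Finset.sum_le_sum fun j hj => ?_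
    rw [Finset.mem_range] at hj
    have := eDist_map_le Hconn rA rAh (e.map g) s(p j, p (j + 1))
    rw [rAg e he, Sym2.map_mk, rAP j (by omega), rAP (j + 1) (by omega), Sym2.eq_swap] at this
    rw [show k - 1 - j + 1 = k - j by omega, show k - 1 - j = k - (j + 1) by omega]
    exact this
  have cAB1 : ∀ e ∈ EA, ∀ f ∈ EB, eDist G e f + k ≤ eDist H (e.map g) f := by
    intro e he f hf
    have hne : e.map g ≠ f := by
      rintro rfl
      exact Finset.disjoint_left.1 dA'B (Finset.mem_image_of_mem _ he) hf
    obtain ⟨u, hu, w, hw, h1⟩ := eDist_exists H hne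
    rw [h1]
    obtain ⟨u0, hu0, rfl⟩ := Sym2.mem_map.1 hu
    have h2 := pot_le_dist φ φh w (g u0) (Hconn _ _)
    have h3 : φ (g u0) = (G.dist u0 (p 0) : ℤ) + k := by
      obtain ⟨x, y, -, h4, h5, rfl⟩ := (memA e).1 he
      rcases Sym2.mem_iff.1 hu0 with rfl | rfl
      · rw [gX _ h4, φX _ h4]
      · rcases h5 with h5 | rfl
        · rw [gX _ h5, φX _ h5]
        · rw [g0, φP k le_rfl, SimpleGraph.dist_self]
          simp
    have h4 : φ w = - (G.dist w (p 0) : ℤ) := by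
      obtain ⟨x, y, -, h4, h5, rfl⟩ := (memB f).1 hf
      rcases Sym2.mem_iff.1 hw with rfl | rfl
      · rw [φY _ h4]
      · rcases h5 with h5 | rfl
        · rw [φY _ h5]
        · rw [φP 0 (by omega), SimpleGraph.dist_self]
          simp
    rw [h3, h4, SimpleGraph.dist_comm (u := w) (v := g u0)] at h2
    have h5 := hG.1.dist_triangle (u := u0) (v := p 0) (w := w)
    rw [SimpleGraph.dist_comm (u := p 0) (v := w)] at h5
    have h6 := eDist_le G hu0 hw
    have h7 : G.dist (p 0) u0 = G.dist u0 (p 0) := SimpleGraph.dist_comm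
    omega
  have neA : EA.Nonempty := by
    obtain ⟨x, hx⟩ := hXne
    have hnx : x ≠ p 0 := by rintro rfl; exact hp0X hx
    obtain ⟨w⟩ := hG.1 x (p 0)
    cases w with
    | nil => exact absurd rfl hnx
    | cons h _ => exact ⟨_, (memA _).2 ⟨x, _, h, hx, xadj x hx _ h, rfl⟩⟩
  have neB : EB.Nonempty := by
    obtain ⟨x, hx⟩ := hYne
    have hnx : x ≠ p 0 := by rintro rfl; exact hp0Y hx
    obtain ⟨w⟩ := hG.1 x (p 0)
    cases w with
    | nil => exact absurd rfl hnx
    | cons h _ => exact ⟨_, (memB _).2 ⟨x, _, h, hx, yadj x hx _ h, rfl⟩⟩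
  have cAB : ∑ e ∈ EA, ∑ f ∈ EB, eDist G e f < ∑ e ∈ EA', ∑ f ∈ EB, eDist H e f := by
    rw [Finset.sum_image ginj]
    refine Finset.sum_lt_sum_of_nonempty neA fun e he => ?_
    refine Finset.sum_lt_sum_of_nonempty neB fun f hf => ?_
    have := cAB1 e he f hf
    omega
  refine ⟨H, ⟨Hconn, Hcp⟩, ?_, ?_⟩
  · rw [EG, EH, Finset.card_union_of_disjoint dABP, Finset.card_union_of_disjoint dA'BP,
      Finset.card_union_of_disjoint dAB, Finset.card_union_of_disjoint dA'B,
      Finset.card_image_of_injOn ginj]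
  · unfold dW
    rw [EG, EH, dsum_union _ (eDist_comm G) _ _ dABP, dsum_union _ (eDist_comm H) _ _ dA'BP,
      dsum_union _ (eDist_comm G) _ _ dAB, dsum_union _ (eDist_comm H) _ _ dA'B,
      Finset.sum_union dAB, Finset.sum_union dA'B]
    omega

/-! ### The base of the pendant path lies on a cycle -/

/-- Lower bound for the change of distances at an edge at distances `A`, `B` from the two
cycle neighbours of the base of the pendant path. -/
def gain (k A B : ℕ) : ℤ :=
  (k : ℤ) * ((A : ℤ) - min (A : ℤ) B) + ((A : ℤ) - min (A : ℤ) (B + 1)) +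
    ((A : ℤ) + k - 1 - min ((A : ℤ) + 1) B)

lemma gain_add (k A B : ℕ) (hk : 1 ≤ k) :
    2 * ((k : ℤ) - 1) + (if A = B then 0 else 1) ≤ gain k A B + gain k B A := by
  unfold gain
  have hk' : (1 : ℤ) ≤ k := by exact_mod_cast hk
  rcases lt_trichotomy A B with h | h | h
  · have h' : (A : ℤ) + 1 ≤ B := by exact_mod_cast h
    rw [if_neg h.ne, min_eq_left (by linarith : (A : ℤ) ≤ B),
      min_eq_left (by linarith : (A : ℤ) ≤ B + 1), min_eq_left h',
      min_eq_right (by linarith : (A : ℤ) ≤ B), min_eq_right h',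
      min_eq_right (by linarith : (A : ℤ) ≤ B + 1)]
    nlinarith
  · subst h
    rw [if_pos rfl, min_self, min_eq_left (by linarith : (A : ℤ) ≤ A + 1),
      min_eq_right (by linarith : (A : ℤ) ≤ A + 1)]
    nlinarith
  · have h' : (B : ℤ) + 1 ≤ A := by exact_mod_cast h
    rw [if_neg h.ne', min_eq_left (by linarith : (B : ℤ) ≤ A),
      min_eq_left (by linarith : (B : ℤ) ≤ A + 1), min_eq_left h',
      min_eq_right (by linarith : (B : ℤ) ≤ A), min_eq_right h',
      min_eq_right (by linarith : (B : ℤ) ≤ A + 1)]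
    nlinarith

lemma path_sum (k : ℕ) (hk : 1 ≤ k) (a b : ℕ → ℕ) (ha0 : a 0 ≤ 1)
    (ha : ∀ j, j < k → a (j + 1) ≤ j + 1) (hb : ∀ j, j ≤ k → 1 ≤ b j)
    (hb' : ∀ j, j ≤ k → k ≤ b j + j + 1) :
    (∑ j ∈ Finset.range (k + 1), (a j : ℤ)) ≤ ∑ j ∈ Finset.range (k + 1), (b j : ℤ) + (k - 1) := by
  obtain ⟨m, rfl⟩ : ∃ m, k = m + 1 := ⟨k - 1, by omega⟩
  rw [Finset.sum_range_succ', Finset.sum_range_succ, Finset.sum_range_succ (fun j => (b j : ℤ)),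
    Finset.sum_range_succ (fun j => (b j : ℤ))]
  have h1 : ∑ j ∈ Finset.range m, (a (j + 1) : ℤ) ≤ ∑ j ∈ Finset.range m, (b j : ℤ) := by
    rw [← Finset.sum_range_reflect (fun j => (b j : ℤ))]
    refine Finset.sum_le_sum fun j hj => ?_
    rw [Finset.mem_range] at hj
    have e1 := ha j (by omega)
    have e2 := hb' (m - 1 - j) (by omega)
    have : a (j + 1) ≤ b (m - 1 - j) := by omega
    exact_mod_cast this
  have h2 := ha m (by omega)
  have h3 := hb m (by omega)
  have h4 := hb (m + 1) (by omega)
  push_cast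
  omega

lemma caseA {V : Type*} [Fintype V] (G Gd : SimpleGraph V) (hG : IsCactus G) (k : ℕ) (p : ℕ → V)
    (hp : PendPath G k p) (hGd : ∀ u w, Gd.Adj u w ↔ G.Adj u w ∧ u ≠ p 0 ∧ w ≠ p 0)
    (c1 c2 : V) (hreach : ∀ w, (∀ i ≤ k, w ≠ p i) → Gd.Reachable c1 w)
    (hc1 : ∀ i ≤ k, c1 ≠ p i) (hc2 : ∀ i ≤ k, c2 ≠ p i) (hc : c1 ≠ c2)
    (ha1 : G.Adj (p 0) c1) (ha2 : G.Adj (p 0) c2)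
    (honly : ∀ w, (∀ i ≤ k, w ≠ p i) → G.Adj (p 0) w → w = c1 ∨ w = c2) :
    (∃ H : SimpleGraph V, IsCactus H ∧ H.edgeFinset.card = G.edgeFinset.card ∧
      (dW G : ℤ) + 2 * (∑ f ∈ G.edgeFinset.filter (fun e => ∀ x ∈ e, ∀ i ≤ k, x ≠ p i),
        gain k (vDist Gd c1 f) (vDist Gd c2 f) - (k - 1)) ≤ dW H) ∧
      G.edgeFinset.card =
        (G.edgeFinset.filter (fun e => ∀ x ∈ e, ∀ i ≤ k, x ≠ p i)).card + (k + 1) + 1 := by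
  have hk := hp.hk
  obtain ⟨ix, hix⟩ := hp.exists_ix
  obtain ⟨R, hR⟩ : ∃ R : V → Prop, ∀ w, R w ↔ ∀ i ≤ k, w ≠ p i := ⟨_, fun _ => Iff.rfl⟩
  simp_rw [← hR] at hreach hc1 hc2 honly ⊢
  have hRp : ∀ i ≤ k, ¬ R (p i) := fun i hi h => (hR _).1 h i hi rfl
  have hcov : ∀ w, R w ∨ ∃ i ≤ k, w = p i := by
    intro w
    by_cases h : R w
    · exact Or.inl h
    · rw [hR] at h
      push Not at h
      exact Or.inr h
  obtain ⟨q, hq0, hqs⟩ : ∃ q : ℕ → V, q 0 = c1 ∧ ∀ i, q (i + 1) = p i :=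
    ⟨fun i => if i = 0 then c1 else p (i - 1), by simp, by simp⟩
  have qR : ∀ i, 1 ≤ i → i ≤ k + 1 → ¬ R (q i) := by
    intro i h1 h2
    obtain ⟨j, rfl⟩ : ∃ j, i = j + 1 := ⟨i - 1, by omega⟩
    rw [hqs]
    exact hRp j (by omega)
  have qadj : ∀ i ≤ k, G.Adj (q i) (q (i + 1)) := by
    intro i hi
    rcases i with _ | i
    · rw [hq0, hqs]; exact ha1.symm
    · rw [hqs, hqs]; exact hp.adj i (by omega)
  have qinj : ∀ i ≤ k + 1, ∀ j ≤ k + 1, q i = q j → i = j := by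
    intro i hi j hj h
    rcases i with _ | i
    · rcases j with _ | j
      · rfl
      · rw [hq0] at h
        exact absurd (h ▸ hc1) (qR _ (by omega) hj)
    · rcases j with _ | j
      · rw [hq0] at h
        exact absurd (h.symm ▸ hc1) (qR _ (by omega) hi)
      · rw [hqs, hqs] at h
        have := hp.inj _ (by omega) _ (by omega) h
        omega
  have qk : q (k + 1) = p k := hqs k
  have q1 : q 1 = p 0 := hqs 0
  have c2q : ∀ i ≤ k + 1, c2 ≠ q i := by
    intro i hi
    rcases i with _ | i
    · rw [hq0]; exact hc.symm
    · intro h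
      exact qR _ (by omega) hi (h ▸ hc2)
  have qe2 : ∀ j ≤ k, s(q j, q (j + 1)) ≠ s(p 0, c2) := by
    intro j hj h
    have : c2 ∈ s(q j, q (j + 1)) := by rw [h]; simp
    rcases Sym2.mem_iff.1 this with h | h
    · exact c2q _ (by omega) h
    · exact c2q _ (by omega) h
  have hnew : ¬ G.Adj (q (k - 1)) (q (k + 1)) := by
    intro h
    rw [qk] at h
    rcases hp.nb k (by omega) le_rfl _ h.symm with h1 | ⟨h1, -⟩
    · rw [← hqs, show k - 1 + 1 = k by omega] at h1
      have := qinj _ (by omega) _ (by omega) h1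
      omega
    · omega
  have hnewne : q (k - 1) ≠ q (k + 1) := fun h => by
    have := qinj _ (by omega) _ (by omega) h
    omega
  obtain ⟨H, Hdef⟩ : ∃ H : SimpleGraph V, ∀ u w, H.Adj u w ↔
      ((G.Adj u w ∧ s(u, w) ≠ s(p 0, c2)) ∨ s(u, w) = s(q (k - 1), q (k + 1))) := ⟨
    { Adj := fun u w => (G.Adj u w ∧ s(u, w) ≠ s(p 0, c2)) ∨ s(u, w) = s(q (k - 1), q (k + 1))
      symm := ⟨by
        intro u w h
        rw [Sym2.eq_swap (a := w) (b := u), G.adj_comm w u]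
        exact h⟩
      loopless := ⟨by
        intro u h
        rcases h with ⟨h, -⟩ | h
        · exact h.ne rfl
        · rcases Sym2.eq_iff.1 h with ⟨h1, h2⟩ | ⟨h1, h2⟩
          · exact hnewne (h1.symm.trans h2)
          · exact hnewne (h2.symm.trans h1)⟩ }, fun u w => Iff.rfl⟩
  have Gcase : ∀ u w, G.Adj u w → ((R u ∧ R w) ∨ (∃ j ≤ k, s(u, w) = s(q j, q (j + 1))) ∨
      s(u, w) = s(p 0, c2)) := by
    have half : ∀ u i, R u → i ≤ k → G.Adj u (p i) →
        ((∃ j ≤ k, s(u, p i) = s(q j, q (j + 1))) ∨ s(u, p i) = s(p 0, c2)) := by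
      intro u i hu hi h
      rcases Nat.eq_zero_or_pos i with rfl | h0
      · rcases honly u hu h.symm with rfl | rfl
        · left; exact ⟨0, by omega, by rw [hq0, hqs]⟩
        · right; exact Sym2.eq_swap
      · rcases hp.nb i h0 hi _ h.symm with h2 | ⟨h3, h2⟩
        · exact absurd (h2 ▸ hu) (hRp _ (by omega))
        · exact absurd (h2 ▸ hu) (hRp _ (by omega))
    intro u w h
    rcases hcov u with hu | ⟨i, hi, rfl⟩
    · rcases hcov w with hw | ⟨j, hj, rfl⟩
      · exact Or.inl ⟨hu, hw⟩
      · exact Or.inr (half u j hu hj h)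
    · rcases hcov w with hw | ⟨j, hj, rfl⟩
      · rw [Sym2.eq_swap]
        exact Or.inr (half w i hw hi h.symm)
      · right; left
        rcases hp.padj hi hj h with rfl | rfl
        · exact ⟨j + 1, by omega, by rw [hqs, hqs, Sym2.eq_swap]⟩
        · exact ⟨i + 1, by omega, by rw [hqs, hqs]⟩
  have RGd : ∀ u w, R u → R w → G.Adj u w → Gd.Adj u w := by
    intro u w hu hw h
    exact (hGd _ _).2 ⟨h, (hR _).1 hu 0 (by omega), (hR _).1 hw 0 (by omega)⟩
  have Hcase : ∀ u w, H.Adj u w → ((R u ∧ R w ∧ Gd.Adj u w) ∨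
      (∃ j ≤ k, s(u, w) = s(q j, q (j + 1))) ∨ s(u, w) = s(q (k - 1), q (k + 1))) := by
    intro u w h
    rcases (Hdef _ _).1 h with ⟨h1, h2⟩ | h1
    · rcases Gcase u w h1 with h3 | h3 | h3
      · exact Or.inl ⟨h3.1, h3.2, RGd u w h3.1 h3.2 h1⟩
      · exact Or.inr (Or.inl h3)
      · exact absurd h3 h2
    · exact Or.inr (Or.inr h1)
  have HQ : ∀ j ≤ k, H.Adj (q j) (q (j + 1)) := fun j hj =>
    (Hdef _ _).2 (Or.inl ⟨qadj j hj, qe2 j hj⟩)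
  have GdH : ∀ u w, Gd.Adj u w → H.Adj u w := by
    intro u w h
    obtain ⟨h1, h2, h3⟩ := (hGd _ _).1 h
    refine (Hdef _ _).2 (Or.inl ⟨h1, fun h4 => ?_⟩)
    have : p 0 ∈ s(u, w) := by rw [h4]; simp
    rcases Sym2.mem_iff.1 this with h | h
    · exact h2 h.symm
    · exact h3 h.symm
  -- connectivity
  have Hconn : H.Connected := by
    apply connected_of_adj hG.1
    intro u w h
    by_cases he : s(u, w) = s(p 0, c2)
    · have hr : H.Reachable (p 0) c2 := by
        have h1 := HQ 0 (by omega)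
        rw [hq0, hqs] at h1
        exact h1.symm.reachable.trans ((hreach c2 hc2).mono (fun u w h => GdH u w h))
      rcases Sym2.eq_iff.1 he with ⟨rfl, rfl⟩ | ⟨rfl, rfl⟩
      · exact hr
      · exact hr.symm
    · exact ((Hdef _ _).2 (Or.inl ⟨h, he⟩)).reachable
  have hGcp : CycProp G := hG.2
  have Hcp : CycProp H := by
    obtain ⟨K, hK⟩ : ∃ K : SimpleGraph V, ∀ u w, K.Adj u w ↔ (u ≠ w ∧
        (u = q k ∨ u = q (k + 1) ∨ u = q (k - 1)) ∧ (w = q k ∨ w = q (k + 1) ∨ w = q (k - 1))) :=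
      ⟨{ Adj := fun u w => (u ≠ w ∧
          (u = q k ∨ u = q (k + 1) ∨ u = q (k - 1)) ∧ (w = q k ∨ w = q (k + 1) ∨ w = q (k - 1)))
         symm := ⟨fun u w h => ⟨h.1.symm, h.2.2, h.2.1⟩⟩
         loopless := ⟨fun u h => h.1 rfl⟩ }, fun _ _ => Iff.rfl⟩
    refine cp_glue H K G {q k, q (k + 1)} (q (k - 1)) ?_ ?_
      (cp_triangle K (q k) (q (k + 1)) (q (k - 1)) fun u w h => ((hK u w).1 h).2) hGcp ?_ ?_
    · rintro (h | h)
      · have := qinj _ (by omega) _ (by omega) h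
        omega
      · exact hnewne h
    · rintro x (rfl | rfl) w h
      · rcases Hcase _ _ h with ⟨h1, -, -⟩ | ⟨j, hj, h1⟩ | h1
        · exact absurd h1 (qR _ (by omega) (by omega))
        · rcases Sym2.eq_iff.1 h1 with ⟨h2, h3⟩ | ⟨h2, h3⟩
          · have := qinj _ (by omega) _ (by omega) h2
            subst this
            left; right; exact h3
          · have := qinj _ (by omega) _ (by omega) h2
            subst this
            right; simpa using h3
        · rcases Sym2.eq_iff.1 h1 with ⟨h2, h3⟩ | ⟨h2, h3⟩
          · have := qinj _ (by omega) _ (by omega) h2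
            omega
          · have := qinj _ (by omega) _ (by omega) h2
            omega
      · rcases Hcase _ _ h with ⟨h1, -, -⟩ | ⟨j, hj, h1⟩ | h1
        · exact absurd h1 (qR _ (by omega) (by omega))
        · rcases Sym2.eq_iff.1 h1 with ⟨h2, h3⟩ | ⟨h2, h3⟩
          · have := qinj _ (by omega) _ (by omega) h2
            omega
          · have := qinj _ (by omega) _ (by omega) h2
            obtain rfl : j = k := by omega
            left; left; exact h3
        · rcases Sym2.eq_iff.1 h1 with ⟨h2, h3⟩ | ⟨h2, h3⟩
          · exact absurd h2.symm hnewne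
          · right; exact h3
    · intro u w h hu hw
      refine (hK _ _).2 ⟨h.ne, ?_, ?_⟩
      · rcases hu with (h | h) | h
        · exact Or.inl h
        · exact Or.inr (Or.inl h)
        · exact Or.inr (Or.inr h)
      · rcases hw with (h | h) | h
        · exact Or.inl h
        · exact Or.inr (Or.inl h)
        · exact Or.inr (Or.inr h)
    · intro u w h hu hw
      rcases (Hdef _ _).1 h with ⟨h1, -⟩ | h1
      · exact h1
      · have : q (k + 1) ∈ s(u, w) := by rw [h1]; simp
        rcases Sym2.mem_iff.1 this with h | h
        · exact absurd (Or.inr h.symm) hu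
        · exact absurd (Or.inr h.symm) hw
  -- edge sets
  obtain ⟨ER, hER⟩ : ∃ ER, ER = G.edgeFinset.filter (fun e => ∀ x ∈ e, R x) := ⟨_, rfl⟩
  rw [← hER]
  let EQ : Finset (Sym2 V) := (Finset.range (k + 1)).image (fun j => s(q j, q (j + 1)))
  have memR : ∀ e, e ∈ ER ↔ e ∈ G.edgeSet ∧ ∀ x ∈ e, R x := by
    intro e
    rw [hER, Finset.mem_filter, SimpleGraph.mem_edgeFinset]
  have memQ : ∀ e, e ∈ EQ ↔ ∃ j ≤ k, e = s(q j, q (j + 1)) := by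
    intro e
    simp only [EQ, Finset.mem_image, Finset.mem_range]
    constructor
    · rintro ⟨j, h, rfl⟩; exact ⟨j, by omega, rfl⟩
    · rintro ⟨j, h, rfl⟩; exact ⟨j, by omega, rfl⟩
  have Qinj : Set.InjOn (fun j => s(q j, q (j + 1))) (Finset.range (k + 1) : Set ℕ) := by
    intro i hi j hj h
    simp only [Finset.coe_range, Set.mem_Iio] at hi hj
    rcases Sym2.eq_iff.1 h with ⟨h1, h2⟩ | ⟨h1, h2⟩
    · exact qinj _ (by omega) _ (by omega) h1
    · have e1 := qinj _ (by omega) _ (by omega) h1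
      have e2 := qinj _ (by omega) _ (by omega) h2
      omega
  have dRQ : Disjoint ER EQ := by
    rw [Finset.disjoint_left]
    intro e h1 h2
    obtain ⟨j, hj, rfl⟩ := (memQ e).1 h2
    exact qR (j + 1) (by omega) (by omega) (((memR _).1 h1).2 _ (by simp))
  have dG : Disjoint (ER ∪ EQ) {s(p 0, c2)} := by
    rw [Finset.disjoint_singleton_right, Finset.mem_union]
    rintro (h | h)
    · exact hRp 0 (by omega) (((memR _).1 h).2 _ (by simp))
    · obtain ⟨j, hj, h⟩ := (memQ _).1 h
      exact qe2 j hj h.symm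
  have dH : Disjoint (ER ∪ EQ) {s(q (k - 1), q (k + 1))} := by
    rw [Finset.disjoint_singleton_right, Finset.mem_union]
    rintro (h | h)
    · exact hnew ((memR _).1 h).1
    · obtain ⟨j, hj, h⟩ := (memQ _).1 h
      have h1 := qadj j hj
      rw [← SimpleGraph.mem_edgeSet, ← h] at h1
      exact hnew h1
  have EG : G.edgeFinset = (ER ∪ EQ) ∪ {s(p 0, c2)} := by
    ext e
    rw [SimpleGraph.mem_edgeFinset, Finset.mem_union, Finset.mem_union, Finset.mem_singleton,
      memR, memQ]
    constructor
    · induction e using Sym2.ind with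
      | _ u w =>
        intro h
        rcases Gcase u w h with h1 | h1 | h1
        · refine Or.inl (Or.inl ⟨h, fun x hx => ?_⟩)
          rcases Sym2.mem_iff.1 hx with rfl | rfl
          · exact h1.1
          · exact h1.2
        · exact Or.inl (Or.inr h1)
        · exact Or.inr h1
    · rintro ((h | ⟨j, hj, rfl⟩) | rfl)
      · exact h.1
      · exact qadj j hj
      · exact ha2
  have EH : H.edgeFinset = (ER ∪ EQ) ∪ {s(q (k - 1), q (k + 1))} := by
    ext e
    rw [SimpleGraph.mem_edgeFinset, Finset.mem_union, Finset.mem_union, Finset.mem_singleton,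
      memR, memQ]
    constructor
    · induction e using Sym2.ind with
      | _ u w =>
        intro h
        rcases Hcase u w h with h1 | h1 | h1
        · refine Or.inl (Or.inl ⟨((hGd _ _).1 h1.2.2).1, fun x hx => ?_⟩)
          rcases Sym2.mem_iff.1 hx with rfl | rfl
          · exact h1.1
          · exact h1.2.1
        · exact Or.inl (Or.inr h1)
        · exact Or.inr h1
    · rintro ((h | ⟨j, hj, rfl⟩) | rfl)
      · induction e using Sym2.ind with
        | _ u w =>
          exact GdH u w (RGd u w (h.2 u (by simp)) (h.2 w (by simp)) h.1)
      · exact HQ j hj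
      · exact (Hdef _ _).2 (Or.inr rfl)
  -- retraction
  let r : V → V := fun w => if w = p k then q k else w
  have rk : r (p k) = q k := by simp [r]
  have rn : ∀ w, w ≠ p k → r w = w := fun w hw => by simp [r, hw]
  have rR : ∀ e ∈ ER, e.map r = e := by
    intro e he
    have h := ((memR e).1 he).2
    induction e using Sym2.ind with
    | _ u w =>
      rw [Sym2.map_mk, rn u ((hR u).1 (h u (by simp)) k le_rfl),
        rn w ((hR w).1 (h w (by simp)) k le_rfl)]
  have rq : ∀ j ≤ k, r (q j) = q j := by
    intro j hj
    apply rn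
    rw [← qk]
    intro h
    have := qinj _ (by omega) _ (by omega) h
    omega
  have rh : ∀ u w, H.Adj u w → r u = r w ∨ G.Adj (r u) (r w) := by
    have key : ∀ a b u w, s(u, w) = s(a, b) → (r a = r b ∨ G.Adj (r a) (r b)) →
        (r u = r w ∨ G.Adj (r u) (r w)) := by
      intro a b u w h h1
      rcases Sym2.eq_iff.1 h with ⟨rfl, rfl⟩ | ⟨rfl, rfl⟩
      · exact h1
      · exact h1.imp Eq.symm fun h => h.symm
    intro u w h
    rcases Hcase u w h with ⟨h1, h2, h3⟩ | ⟨j, hj, h1⟩ | h1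
    · right
      rw [rn u ((hR u).1 h1 k le_rfl), rn w ((hR w).1 h2 k le_rfl)]
      exact ((hGd _ _).1 h3).1
    · refine key _ _ _ _ h1 ?_
      rcases Nat.lt_or_ge j k with h2 | h2
      · right
        rw [rq j hj, rq (j + 1) h2]
        exact qadj j hj
      · obtain rfl : j = k := by omega
        left
        rw [rq j le_rfl, qk, rk]
    · refine key _ _ _ _ h1 (Or.inr ?_)
      rw [rq (k - 1) (by omega), qk, rk]
      have := qadj (k - 1) (by omega)
      rwa [show k - 1 + 1 = k by omega] at this
  -- potential
  let φ : V → ℤ := fun w => if R w then - (Gd.dist c1 w : ℤ) else ((min (ix w + 1) k : ℕ) : ℤ)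
  have φR : ∀ w, R w → φ w = - (Gd.dist c1 w : ℤ) := fun w hw => by simp [φ, hw]
  have φq : ∀ j ≤ k + 1, φ (q j) = ((min j k : ℕ) : ℤ) := by
    intro j hj
    rcases j with _ | j
    · rw [hq0, φR _ hc1, SimpleGraph.dist_self]
      simp
    · have h1 := qR (j + 1) (by omega) hj
      rw [hqs] at h1 ⊢
      simp only [φ, h1, if_false, hix j (by omega)]
  have φh : ∀ u w, H.Adj u w → φ w - φ u ≤ 1 := by
    have key : ∀ a b u w, s(u, w) = s(a, b) → (φ a - φ b ≤ 1 ∧ φ b - φ a ≤ 1) →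
        φ w - φ u ≤ 1 := by
      intro a b u w h h1
      rcases Sym2.eq_iff.1 h with ⟨rfl, rfl⟩ | ⟨rfl, rfl⟩
      · exact h1.2
      · exact h1.1
    intro u w h
    rcases Hcase u w h with ⟨h1, h2, h3⟩ | ⟨j, hj, h1⟩ | h1
    · rw [φR u h1, φR w h2]
      have h4 : Gd.dist w u = 1 := SimpleGraph.dist_eq_one_iff_adj.2 h3.symm
      obtain ⟨x, hx⟩ := (hreach w h2).exists_walk_length_eq_dist
      have h5 := SimpleGraph.dist_le (x.concat h3.symm)
      rw [Walk.length_concat, hx] at h5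
      omega
    · refine key _ _ _ _ h1 ?_
      rw [φq j (by omega), φq (j + 1) (by omega)]
      omega
    · refine key _ _ _ _ h1 ?_
      rw [φq _ (by omega), φq _ (by omega)]
      omega
  have Hlow : ∀ u w, φ w - φ u ≤ H.dist u w := fun u w => pot_le_dist φ φh u w (Hconn u w)
  -- upper bounds in `G`
  have up1 : ∀ u, R u → G.dist c1 u ≤ Gd.dist c1 u := fun u hu =>
    dist_le_of_weakHom (fun x => x) (fun a b h => Or.inr ((hGd a b).1 h).1) c1 u (hreach u hu)
  have up2 : ∀ u, R u → G.dist c2 u ≤ Gd.dist c2 u := fun u hu =>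
    dist_le_of_weakHom (fun x => x) (fun a b h => Or.inr ((hGd a b).1 h).1) c2 u
      ((hreach c2 hc2).symm.trans (hreach u hu))
  have upp : ∀ i ≤ k, G.dist (p 0) (p i) ≤ i := by
    intro i hi
    have := hp.dist_le 0 i (by omega)
    rwa [Nat.zero_add] at this
  have upc : ∀ c, G.Adj (p 0) c → ∀ u i, i ≤ k → G.dist u (p i) ≤ G.dist c u + 1 + i := by
    intro c h u i hi
    have h1 := hG.1.dist_triangle (u := u) (v := c) (w := p i)
    have h2 := hG.1.dist_triangle (u := c) (v := p 0) (w := p i)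
    have h3 : G.dist c (p 0) = 1 := SimpleGraph.dist_eq_one_iff_adj.2 h.symm
    have h4 := upp i hi
    have h5 : G.dist u c = G.dist c u := SimpleGraph.dist_comm
    omega
  have upq : ∀ i j, i + j ≤ k + 1 → G.dist (q i) (q (i + j)) ≤ j := by
    intro i j hij
    rcases i with _ | i
    · rcases j with _ | j
      · simp
      · rw [Nat.zero_add, hq0, hqs]
        have h2 := hG.1.dist_triangle (u := c1) (v := p 0) (w := p j)
        have h3 : G.dist c1 (p 0) = 1 := SimpleGraph.dist_eq_one_iff_adj.2 ha1.symm
        have h4 := upp j (by omega)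
        omega
    · rw [show i + 1 + j = i + j + 1 by omega, hqs, hqs]
      exact hp.dist_le i j (by omega)
  -- comparison of the pieces
  have cRR : ∑ e ∈ ER, ∑ f ∈ ER, eDist G e f ≤ ∑ e ∈ ER, ∑ f ∈ ER, eDist H e f := by
    refine Finset.sum_le_sum fun e he => Finset.sum_le_sum fun f hf => ?_
    have := eDist_map_le Hconn r rh e f
    rwa [rR e he, rR f hf] at this
  have cQlt : ∀ i j, i < j → j ≤ k →
      eDist G s(q i, q (i + 1)) s(q j, q (j + 1)) ≤ eDist H s(q i, q (i + 1)) s(q j, q (j + 1)) := by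
    intro i j hij hj
    have h1 := eDist_le G (e := s(q i, q (i + 1))) (f := s(q j, q (j + 1))) (u := q (i + 1))
      (w := q j) (by simp) (by simp)
    have h2 := upq (i + 1) (j - (i + 1)) (by omega)
    rw [show i + 1 + (j - (i + 1)) = j by omega] at h2
    have hne : s(q i, q (i + 1)) ≠ s(q j, q (j + 1)) := fun h => by
      have := Qinj (by simp; omega) (by simp; omega) h
      omega
    obtain ⟨u, hu, w, hw, h3⟩ := eDist_exists H hne
    have h4 := Hlow u w
    have h5 : φ u ≤ i + 1 := by
      rcases Sym2.mem_iff.1 hu with rfl | rfl <;> rw [φq _ (by omega)] <;> omega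
    have h6 : (j : ℤ) ≤ φ w := by
      rcases Sym2.mem_iff.1 hw with rfl | rfl <;> rw [φq _ (by omega)] <;> omega
    omega
  have cQQ : ∑ e ∈ EQ, ∑ f ∈ EQ, eDist G e f ≤ ∑ e ∈ EQ, ∑ f ∈ EQ, eDist H e f := by
    refine Finset.sum_le_sum fun e he => Finset.sum_le_sum fun f hf => ?_
    obtain ⟨i, hi, rfl⟩ := (memQ e).1 he
    obtain ⟨j, hj, rfl⟩ := (memQ f).1 hf
    rcases lt_trichotomy i j with h | h | h
    · exact cQlt i j h hj
    · subst h
      rw [eDist_self, eDist_self]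
    · rw [eDist_comm G, eDist_comm H]
      exact cQlt j i h hi
  have cQs : (∑ e ∈ EQ, (eDist G e s(p 0, c2) : ℤ)) ≤
      ∑ e ∈ EQ, (eDist H e s(q (k - 1), q (k + 1)) : ℤ) + (k - 1) := by
    rw [Finset.sum_image Qinj, Finset.sum_image Qinj]
    apply path_sum k hk (fun j => eDist G s(q j, q (j + 1)) s(p 0, c2))
      (fun j => eDist H s(q j, q (j + 1)) s(q (k - 1), q (k + 1)))
    · have := eDist_le G (e := s(q 0, q (0 + 1))) (f := s(p 0, c2)) (u := q 1) (w := p 0)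
        (by simp) (by simp)
      have h0 : G.dist (q 1) (p 0) = 0 := by rw [q1, SimpleGraph.dist_self]
      rw [h0] at this; exact this
    · intro j hj
      have := eDist_le G (e := s(q (j + 1), q (j + 1 + 1))) (f := s(p 0, c2)) (u := q (j + 1))
        (w := p 0) (by simp) (by simp)
      rw [hqs j, SimpleGraph.dist_comm] at this
      have h2 := upp j (by omega)
      rw [← hqs j] at this
      rw [← hqs j] at h2
      show eDist G _ _ ≤ _
      omega
    · intro j hj
      have hne : s(q j, q (j + 1)) ≠ s(q (k - 1), q (k + 1)) := by
        intro h
        exact Finset.disjoint_singleton_right.1 dH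
          (Finset.mem_union_right _ ((memQ _).2 ⟨j, hj, h.symm⟩))
      obtain ⟨u, hu, w, hw, h3⟩ := eDist_exists H hne
      show 1 ≤ eDist H _ _
      omega
    · intro j hj
      have hne : s(q j, q (j + 1)) ≠ s(q (k - 1), q (k + 1)) := by
        intro h
        exact Finset.disjoint_singleton_right.1 dH
          (Finset.mem_union_right _ ((memQ _).2 ⟨j, hj, h.symm⟩))
      obtain ⟨u, hu, w, hw, h3⟩ := eDist_exists H hne
      show k ≤ eDist H _ _ + j + 1
      have h4 := Hlow u w
      have h5 : φ u ≤ j + 1 := by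
        rcases Sym2.mem_iff.1 hu with rfl | rfl <;> rw [φq _ (by omega)] <;> omega
      have h6 : (k : ℤ) - 1 ≤ φ w := by
        rcases Sym2.mem_iff.1 hw with rfl | rfl <;> rw [φq _ (by omega)] <;> omega
      omega
  have cRf : ∀ f ∈ ER, (∑ e ∈ EQ, (eDist G f e : ℤ)) + eDist G f s(p 0, c2) +
      gain k (vDist Gd c1 f) (vDist Gd c2 f) ≤
      (∑ e ∈ EQ, (eDist H f e : ℤ)) + eDist H f s(q (k - 1), q (k + 1)) := by
    intro f hf
    have hfR := ((memR f).1 hf).2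
    obtain ⟨u1, hu1, hA⟩ := vDist_exists Gd c1 f
    obtain ⟨u2, hu2, hB⟩ := vDist_exists Gd c2 f
    have hφ : ∀ u ∈ f, φ u ≤ - (vDist Gd c1 f : ℤ) := by
      intro u hu
      rw [φR u (hfR u hu)]
      have := vDist_le Gd c1 hu
      omega
    have a1 := up1 u1 (hfR u1 hu1)
    have a2 := up2 u2 (hfR u2 hu2)
    rw [← hA] at a1
    rw [← hB] at a2
    obtain ⟨A, hAd⟩ : ∃ A, A = vDist Gd c1 f := ⟨_, rfl⟩
    obtain ⟨B, hBd⟩ : ∃ B, B = vDist Gd c2 f := ⟨_, rfl⟩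
    rw [← hAd] at a1 hφ ⊢
    rw [← hBd] at a2 ⊢
    have lowQ : ∀ j ≤ k, A + j + 1 ≤ eDist H f s(q j, q (j + 1)) := by
      intro j hj
      have hne : f ≠ s(q j, q (j + 1)) := by
        intro h
        exact Finset.disjoint_left.1 dRQ hf ((memQ _).2 ⟨j, hj, h⟩)
      obtain ⟨u, hu, w, hw, h3⟩ := eDist_exists H hne
      have h4 := Hlow u w
      have h5 := hφ u hu
      have h6 : (j : ℤ) ≤ φ w := by
        rcases Sym2.mem_iff.1 hw with rfl | rfl <;> rw [φq _ (by omega)] <;> omega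
      omega
    have lowN : A + k ≤ eDist H f s(q (k - 1), q (k + 1)) := by
      have hne : f ≠ s(q (k - 1), q (k + 1)) := by
        rintro rfl
        exact Finset.disjoint_singleton_right.1 dH (Finset.mem_union_left _ hf)
      obtain ⟨u, hu, w, hw, h3⟩ := eDist_exists H hne
      have h4 := Hlow u w
      have h5 := hφ u hu
      have h6 : (k : ℤ) - 1 ≤ φ w := by
        rcases Sym2.mem_iff.1 hw with rfl | rfl <;> rw [φq _ (by omega)] <;> omega
      omega
    have b1 : ∀ i ≤ k, G.dist u1 (p i) ≤ A + 1 + i := fun i hi => by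
      have := upc c1 ha1 u1 i hi
      omega
    have b2 : ∀ i ≤ k, G.dist u2 (p i) ≤ B + 1 + i := fun i hi => by
      have := upc c2 ha2 u2 i hi
      omega
    have g0 : (eDist G f s(q 0, q (0 + 1)) : ℤ) ≤ min (A : ℤ) (B + 1) + 1 := by
      have h1 := eDist_le G (f := s(q 0, q (0 + 1))) (w := q 0) hu1 (by simp)
      have h2 := eDist_le G (f := s(q 0, q (0 + 1))) (w := q (0 + 1)) hu2 (by simp)
      have h3 := b2 0 (by omega)
      rw [← hqs 0] at h3
      have h4 : G.dist u1 (q 0) = G.dist c1 u1 := by rw [hq0, SimpleGraph.dist_comm]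
      omega
    have gs : ∀ j < k, (eDist G f s(q (j + 1), q (j + 1 + 1)) : ℤ) ≤ min (A : ℤ) B + j + 2 := by
      intro j hj
      have h1 := eDist_le G (f := s(q (j + 1), q (j + 1 + 1))) (w := q (j + 1)) hu1 (by simp)
      have h2 := eDist_le G (f := s(q (j + 1), q (j + 1 + 1))) (w := q (j + 1)) hu2 (by simp)
      have h3 := b1 j (by omega)
      have h4 := b2 j (by omega)
      rw [← hqs j] at h3 h4
      omega
    have gN : (eDist G f s(p 0, c2) : ℤ) ≤ min ((A : ℤ) + 1) B + 1 := by
      have h1 := eDist_le G (f := s(p 0, c2)) (w := p 0) hu1 (by simp)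
      have h2 := eDist_le G (f := s(p 0, c2)) (w := c2) hu2 (by simp)
      have h3 := b1 0 (by omega)
      have h4 : G.dist u2 c2 = G.dist c2 u2 := SimpleGraph.dist_comm
      omega
    rw [Finset.sum_image Qinj, Finset.sum_image Qinj, Finset.sum_range_succ',
      Finset.sum_range_succ' (fun j => (eDist H f s(q j, q (j + 1)) : ℤ))]
    have hs : (∑ j ∈ Finset.range k, (eDist G f s(q (j + 1), q (j + 1 + 1)) : ℤ)) +
        k * ((A : ℤ) - min (A : ℤ) B) ≤
        ∑ j ∈ Finset.range k, (eDist H f s(q (j + 1), q (j + 1 + 1)) : ℤ) := by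
      have e1 : (k : ℤ) * ((A : ℤ) - min (A : ℤ) B) =
          ∑ _j ∈ Finset.range k, ((A : ℤ) - min (A : ℤ) B) := by
        rw [Finset.sum_const, Finset.card_range, nsmul_eq_mul]
      rw [e1, ← Finset.sum_add_distrib]
      refine Finset.sum_le_sum fun j hj => ?_
      rw [Finset.mem_range] at hj
      have h1 := gs j hj
      have h2 := lowQ (j + 1) (by omega)
      zify at h2
      linarith
    have l0 := lowQ 0 (by omega)
    zify at l0 lowN
    unfold gain
    push_cast at l0
    linarith
  refine ⟨⟨H, ⟨Hconn, Hcp⟩, ?_, ?_⟩, ?_⟩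
  · rw [EG, EH, Finset.card_union_of_disjoint dG, Finset.card_union_of_disjoint dH]
    simp
  · have cR := Finset.sum_le_sum cRf
    simp only [Finset.sum_add_distrib] at cR
    unfold dW
    rw [EG, EH, dsum_union _ (eDist_comm G) _ _ dG, dsum_union _ (eDist_comm H) _ _ dH,
      dsum_union _ (eDist_comm G) _ _ dRQ, dsum_union _ (eDist_comm H) _ _ dRQ]
    simp only [Finset.sum_singleton, eDist_self, Finset.sum_union dRQ]
    zify at cRR cQQ
    push_cast
    linarith
  · rw [EG, Finset.card_union_of_disjoint dG, Finset.card_union_of_disjoint dRQ,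
      Finset.card_image_of_injOn Qinj]
    simp


/-! ### Main theorem -/

lemma avoid_support {V : Type*} {Gd : SimpleGraph V} {z : V} (hz : ∀ w, ¬ Gd.Adj w z) {u v : V}
    (Q : Gd.Walk u v) (hu : u ≠ z) : z ∉ Q.support := by
  induction Q with
  | nil => simpa using hu.symm
  | cons h Q ih =>
    rw [Walk.support_cons, List.mem_cons, not_or]
    exact ⟨hu.symm, ih (fun h2 => hz _ (h2 ▸ h))⟩

lemma cyc_exists {V : Type*} {G Gd : SimpleGraph V} {z : V}
    (hGd : ∀ u w, Gd.Adj u w ↔ G.Adj u w ∧ u ≠ z ∧ w ≠ z) {c d : V} (hcd : c ≠ d)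
    (hc : G.Adj z c) (hd : G.Adj z d) (hr : Gd.Reachable c d) :
    ∃ C : G.Walk d d, C.IsCycle ∧ z ∈ C.support ∧ c ∈ C.support ∧ s(z, d) ∈ C.edges ∧
      ∀ x, s(z, x) ∈ C.edges → x = c ∨ x = d := by
  obtain ⟨Q, hQ⟩ := hr.exists_isPath
  have hle : Gd ≤ G := fun u w h => ((hGd u w).1 h).1
  have hz : z ∉ (Q.mapLe hle).support := by
    rw [Walk.support_mapLe_eq_support]
    exact avoid_support (fun w h => ((hGd w z).1 h).2.2 rfl) Q hc.ne.symm
  refine ⟨Walk.cons hd.symm (Walk.cons hc (Q.mapLe hle)), ?_, by simp, by simp, by simp [Sym2.eq_swap], ?_⟩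
  · rw [Walk.cons_isCycle_iff, Walk.cons_isPath_iff]
    refine ⟨⟨hQ.mapLe hle, hz⟩, ?_⟩
    rw [Walk.edges_cons, List.mem_cons, not_or]
    constructor
    · intro h
      rw [Sym2.eq_swap, Sym2.congr_right] at h
      exact hcd h.symm
    · intro h
      exact hz (Walk.snd_mem_support_of_mem_edges _ h)
  · intro x hx
    rw [Walk.edges_cons, Walk.edges_cons, List.mem_cons, List.mem_cons] at hx
    rcases hx with h | h | h
    · right
      rwa [Sym2.eq_swap (a := d), Sym2.congr_right] at h
    · left
      rwa [Sym2.congr_right] at h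
    · exact absurd (Walk.fst_mem_support_of_mem_edges _ h) hz

lemma closed_reach {V : Type*} {Gd : SimpleGraph V} (S : V → Prop)
    (hS : ∀ u w, S u → Gd.Adj u w → S w) {u v : V} (h : Gd.Reachable u v) (hu : S u) : S v := by
  obtain ⟨Q⟩ := h
  induction Q with
  | nil => exact hu
  | cons h Q ih => exact ih (hS _ _ hu h)

theorem stmt17 {V : Type} [Fintype V] (n t : ℕ) (hn5 : 5 ≤ n) (ht : 2 ≤ t)
    (hn : 2 * t + 1 ≤ n)
    (G : SimpleGraph V) (hG : IsCactus G)
    (hcard : Fintype.card V = n) (hedges : G.edgeFinset.card = n - 1 + t)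
    (hmax : ∀ (W : Type) [Fintype W] (H : SimpleGraph W), IsCactus H →
      Fintype.card W = n → H.edgeFinset.card = n - 1 + t → edgeWiener H ≤ edgeWiener G) :
    ¬ ∃ (k : ℕ) (p : ℕ → V), 1 ≤ k ∧
        (∀ i ≤ k, ∀ j ≤ k, p i = p j → i = j) ∧
        (∀ i < k, G.Adj (p i) (p (i + 1))) ∧
        3 ≤ G.degree (p 0) ∧
        (∀ i, 0 < i → i < k → G.degree (p i) = 2) ∧
        G.degree (p k) = 1 := by
  rintro ⟨k, p, hk, inj, adj, h3, h2, h1⟩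
  have hmx : ∀ H : SimpleGraph V, IsCactus H → H.edgeFinset.card = G.edgeFinset.card →
      dW H ≤ dW G := by
    intro H hH hc
    exact edgeWiener_le_iff G H (hmax V H hH hcard (hc.trans hedges))
  have hp : PendPath G k p := by
    refine ⟨hk, inj, adj, ?_⟩
    intro i hi hik w hw
    have ha : G.Adj (p i) (p (i - 1)) := by
      have := adj (i - 1) (by omega)
      rw [Nat.sub_add_cancel hi] at this
      exact this.symm
    rcases Nat.lt_or_ge i k with hlt | hge
    · by_contra hcon
      push Not at hcon
      have hsub : ({w, p (i - 1), p (i + 1)} : Finset V) ⊆ G.neighborFinset (p i) := by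
        intro x hx
        simp only [Finset.mem_insert, Finset.mem_singleton] at hx
        rw [SimpleGraph.mem_neighborFinset]
        rcases hx with rfl | rfl | rfl
        · exact hw
        · exact ha
        · exact adj i hlt
      have hcd := Finset.card_le_card hsub
      rw [SimpleGraph.card_neighborFinset_eq_degree, h2 i hi hlt,
        Finset.card_eq_three.2 ⟨w, p (i - 1), p (i + 1), hcon.1, hcon.2 hlt,
          fun h => by have := inj _ (by omega) _ (by omega) h; omega, rfl⟩] at hcd
      omega
    · left
      have hik2 : i = k := by omega
      subst hik2
      rw [← SimpleGraph.card_neighborFinset_eq_degree] at h1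
      exact Finset.card_le_one.1 h1.le _ (by rwa [SimpleGraph.mem_neighborFinset]) _
        (by rwa [SimpleGraph.mem_neighborFinset])
  obtain ⟨Gd, hGd⟩ : ∃ Gd : SimpleGraph V, ∀ u w, Gd.Adj u w ↔ G.Adj u w ∧ u ≠ p 0 ∧ w ≠ p 0 :=
    ⟨⟨fun u w => G.Adj u w ∧ u ≠ p 0 ∧ w ≠ p 0, ⟨fun u w h => ⟨h.1.symm, h.2.2, h.2.1⟩⟩,
      ⟨fun u h => h.1.ne rfl⟩⟩, fun _ _ => Iff.rfl⟩
  obtain ⟨c1, hc1m, c2, hc2m, hc⟩ : ∃ c1 ∈ (G.neighborFinset (p 0)).erase (p 1),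
      ∃ c2 ∈ (G.neighborFinset (p 0)).erase (p 1), c1 ≠ c2 := by
    apply Finset.one_lt_card.1
    rw [← SimpleGraph.card_neighborFinset_eq_degree] at h3
    have := Finset.pred_card_le_card_erase (s := G.neighborFinset (p 0)) (a := p 1)
    omega
  rw [Finset.mem_erase, SimpleGraph.mem_neighborFinset] at hc1m hc2m
  obtain ⟨hc11, ha1⟩ := hc1m
  obtain ⟨hc21, ha2⟩ := hc2m
  have hnp : ∀ c, c ≠ p 1 → G.Adj (p 0) c → ∀ i ≤ k, c ≠ p i := by
    rintro c hc1 hac i hi rfl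
    have := hp.padj (Nat.zero_le k) hi hac
    exact hc1 (by congr 1; omega)
  have hc1 := hnp c1 hc11 ha1
  have hc2 := hnp c2 hc21 ha2
  have hclosed : ∀ u w, (∀ i ≤ k, u ≠ p i) → Gd.Adj u w → (∀ i ≤ k, w ≠ p i) := by
    rintro u w hu huw i hi rfl
    have h := (hGd _ _).1 huw
    rcases Nat.eq_zero_or_pos i with h0 | h0
    · exact h.2.2 (by rw [h0])
    · rcases hp.nb i h0 hi u h.1.symm with h5 | ⟨h6, h5⟩
      · exact hu _ (by omega) h5
      · exact hu _ (by omega) h5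
  have hXP : ∀ w, Gd.Reachable c1 w → ∀ i ≤ k, w ≠ p i := fun w hw =>
    closed_reach (fun w => ∀ i ≤ k, w ≠ p i) hclosed hw hc1
  have hreach : ∀ w, (∀ i ≤ k, w ≠ p i) → Gd.Reachable c1 w := by
    by_contra hcon
    push Not at hcon
    obtain ⟨y, hy, hyr⟩ := hcon
    obtain ⟨H, hH, hHc, hlt⟩ := caseB G hG k p hp {w | Gd.Reachable c1 w}
      {w | ¬ Gd.Reachable c1 w ∧ ∀ i ≤ k, w ≠ p i} (by
        intro w
        by_cases h : Gd.Reachable c1 w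
        · exact Or.inl h
        · by_cases h' : ∀ i ≤ k, w ≠ p i
          · exact Or.inr (Or.inl ⟨h, h'⟩)
          · push Not at h'
            exact Or.inr (Or.inr h'))
      (fun w hw h => h.1 hw) (fun i hi h => hXP _ h i hi rfl) (fun i hi h => h.2 i hi rfl)
      (fun x hx z hz hxz => hz.1 (Reachable.trans hx (Adj.reachable
        ((hGd _ _).2 ⟨hxz, hXP x hx 0 (Nat.zero_le _), hz.2 0 (Nat.zero_le _)⟩))))
      ⟨c1, Reachable.refl _⟩ ⟨y, hyr, hy⟩
    exact absurd (hmx H hH hHc) (by omega)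
  have honly : ∀ w, (∀ i ≤ k, w ≠ p i) → G.Adj (p 0) w → w = c1 ∨ w = c2 := by
    intro w hw haw
    by_contra hcon
    push Not at hcon
    obtain ⟨C, hC, hz, hcc, hed, -⟩ := cyc_exists hGd hc ha1 ha2 (hreach c2 hc2)
    obtain ⟨D, hD, hz', hcc', -, hon⟩ := cyc_exists hGd hcon.1.symm ha1 haw (hreach w hw)
    have hle := hG.2 _ _ C D hC hD (by
      intro h
      have h7 : s(p 0, c2) ∈ D.edges := by
        rw [← List.mem_toFinset, ← h, List.mem_toFinset]
        exact hed
      rcases hon _ h7 with h8 | h8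
      · exact hc h8.symm
      · exact hcon.2 h8.symm)
    have := Finset.card_le_one.1 hle (p 0) (by simp [hz, hz']) c1 (by simp [hcc, hcc'])
    exact ha1.ne this
  have hreach2 : ∀ w, (∀ i ≤ k, w ≠ p i) → Gd.Reachable c2 w := fun w hw =>
    (hreach c2 hc2).symm.trans (hreach w hw)
  obtain ⟨⟨H1, hH1, hHc1, hle1⟩, hcnt⟩ := caseA G Gd hG k p hp hGd c1 c2 hreach hc1 hc2 hc ha1 ha2 honly
  obtain ⟨⟨H2, hH2, hHc2, hle2⟩, -⟩ := caseA G Gd hG k p hp hGd c2 c1 hreach2 hc2 hc1 hc.symm ha2 ha1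
    (fun w hw h => (honly w hw h).symm)
  have hm1 : (dW H1 : ℤ) ≤ dW G := by exact_mod_cast hmx H1 hH1 hHc1
  have hm2 : (dW H2 : ℤ) ≤ dW G := by exact_mod_cast hmx H2 hH2 hHc2
  obtain ⟨E, hE⟩ : ∃ E, E = G.edgeFinset.filter (fun e => ∀ x ∈ e, ∀ i ≤ k, x ≠ p i) := ⟨_, rfl⟩
  rw [← hE] at hle1 hle2 hcnt
  have hk' : (1 : ℤ) ≤ k := by exact_mod_cast hk
  have hsum : ∑ f ∈ E, (gain k (vDist Gd c1 f) (vDist Gd c2 f) +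
      gain k (vDist Gd c2 f) (vDist Gd c1 f)) ≤ 2 * ((k : ℤ) - 1) := by
    rw [Finset.sum_add_distrib]
    linarith
  have hterm : ∀ f ∈ E, (0 : ℤ) ≤ gain k (vDist Gd c1 f) (vDist Gd c2 f) +
      gain k (vDist Gd c2 f) (vDist Gd c1 f) := by
    intro f _
    have := gain_add k (vDist Gd c1 f) (vDist Gd c2 f) hk
    split_ifs at this <;> linarith
  have hAB : ∀ f ∈ E, vDist Gd c1 f = vDist Gd c2 f := by
    intro f hf
    by_contra hne
    have h8 := Finset.single_le_sum hterm hf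
    have h9 := gain_add k (vDist Gd c1 f) (vDist Gd c2 f) hk
    rw [if_neg hne] at h9
    linarith
  have hEmem : ∀ u w, Gd.Adj u w → (∀ i ≤ k, u ≠ p i) → s(u, w) ∈ E := by
    intro u w h hu
    rw [hE, Finset.mem_filter, SimpleGraph.mem_edgeFinset]
    refine ⟨((hGd _ _).1 h).1, ?_⟩
    intro x hx
    rcases Sym2.mem_iff.1 hx with rfl | rfl
    · exact hu
    · exact hclosed _ _ hu h
  have hzero : ∀ f ∈ E, ∀ c, (∀ w, (∀ i ≤ k, w ≠ p i) → Gd.Reachable c w) →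
      (vDist Gd c f = 0 ↔ c ∈ f) := by
    intro f hf c hcr
    constructor
    · intro h
      obtain ⟨u, hu, h9⟩ := vDist_exists Gd c f
      rw [hE, Finset.mem_filter] at hf
      have := ((hcr u (hf.2 u hu)).dist_eq_zero_iff).1 (by omega)
      rwa [this]
    · intro h
      have := vDist_le Gd c h
      rw [SimpleGraph.dist_self] at this
      omega
  have hboth : ∀ f ∈ E, (c1 ∈ f ↔ c2 ∈ f) := by
    intro f hf
    rw [← hzero f hf c1 hreach, ← hzero f hf c2 hreach2, hAB f hf]
  have hall : ∀ w, (∀ i ≤ k, w ≠ p i) → w = c1 ∨ w = c2 := by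
    intro w hw
    refine closed_reach (fun w => w = c1 ∨ w = c2) ?_ (hreach w hw) (Or.inl rfl)
    rintro u x (rfl | rfl) hux
    · have := (hboth _ (hEmem _ _ hux hc1)).1 (by simp)
      rcases Sym2.mem_iff.1 this with h | h
      · exact absurd h.symm hc
      · exact Or.inr h.symm
    · have := (hboth _ (hEmem _ _ hux hc2)).2 (by simp)
      rcases Sym2.mem_iff.1 this with h | h
      · exact absurd h hc
      · exact Or.inl h.symm
  have hEsub : E ⊆ {s(c1, c2)} := by
    intro f hf
    have hf' := hf
    rw [hE, Finset.mem_filter] at hf'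
    obtain ⟨u, hu⟩ : ∃ u, u ∈ f := ⟨_, Sym2.out_fst_mem f⟩
    have h1 : c1 ∈ f := by
      rcases hall u (hf'.2 u hu) with rfl | rfl
      · exact hu
      · exact (hboth f hf).2 hu
    rw [Finset.mem_singleton]
    exact (Sym2.mem_and_mem_iff hc).1 ⟨h1, (hboth f hf).1 h1⟩
  have hEc := Finset.card_le_card hEsub
  rw [Finset.card_singleton] at hEc
  have hVc : k + 3 ≤ Fintype.card V := by
    have himg : ((Finset.range (k + 1)).image p).card = k + 1 := by
      rw [Finset.card_image_of_injOn, Finset.card_range]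
      intro i hi j hj hij
      simp only [Finset.coe_range, Set.mem_Iio] at hi hj
      exact inj i (by omega) j (by omega) hij
    have hn2 : c2 ∉ (Finset.range (k + 1)).image p := by
      rw [Finset.mem_image]
      rintro ⟨i, hi, h⟩
      rw [Finset.mem_range] at hi
      exact hc2 i (by omega) h.symm
    have hn1 : c1 ∉ insert c2 ((Finset.range (k + 1)).image p) := by
      rw [Finset.mem_insert, Finset.mem_image]
      rintro (h | ⟨i, hi, h⟩)
      · exact hc h
      · rw [Finset.mem_range] at hi
        exact hc1 i (by omega) h.symm
    have := Finset.card_le_univ (insert c1 (insert c2 ((Finset.range (k + 1)).image p)))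
    rw [Finset.card_insert_of_notMem hn1, Finset.card_insert_of_notMem hn2, himg] at this
    omega
  omega
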